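/- Fix an integer r ≥ 1 and positive integers l_1, ..., l_r. For every real ε > 0 there exists N such that for all integers n_1, ..., n_r with 1 < n_1 | n_2 | ... | n_r, ω(n_i) = l_i for every i, gcd(n_i, n_r/n_i) = 1 for every i, and P^-(n_r) ≥ N, one has |K(C_{n_1} ⊕ ... ⊕ C_{n_r}) − Σ_{i=1}^r l_i| < ε. -/

import Mathlib

open scoped BigOperators

attribute [local instance] Classical.propDecidable

/-- A sequence (multiset) over `G` is zero-sumfree if no nonempty sub-multiset sums to `0`. -/
def IsZeroSumFree {G : Type*} [AddCommGroup G] (S : Multiset G) : Prop :=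
  ∀ T : Multiset G, T ≤ S → T ≠ 0 → T.sum ≠ 0

/-- A minimal zero-sum sequence: sum `0`, and no nonempty proper sub-multiset sums to `0`. -/
def IsMinimalZeroSum {G : Type*} [AddCommGroup G] (S : Multiset G) : Prop :=
  S.sum = 0 ∧ ∀ T : Multiset G, T < S → T ≠ 0 → T.sum ≠ 0

/-- The cross number of a sequence: `k(S) = Σ_{g ∈ S} 1/ord(g)`. -/
noncomputable def crossNumber {G : Type*} [AddCommGroup G] (S : Multiset G) : ℝ :=
  (S.map fun g => (1 : ℝ) / (addOrderOf g)).sum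

/-- The little cross number `k(G)`: max of `k(S)` over zero-sumfree sequences `S` over `G`. -/
noncomputable def littleCrossNumber (G : Type*) [AddCommGroup G] : ℝ :=
  sSup {x : ℝ | ∃ S : Multiset G, IsZeroSumFree S ∧ crossNumber S = x}

/-- The cross number `K(G)`: max of `k(S)` over minimal zero-sum sequences `S` over `G`. -/
noncomputable def bigCrossNumber (G : Type*) [AddCommGroup G] : ℝ :=
  sSup {x : ℝ | ∃ S : Multiset G, IsMinimalZeroSum S ∧ crossNumber S = x}

/-- The Davenport constant `D(G)`. -/
noncomputable def davenport (G : Type*) [AddCommGroup G] : ℕ :=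
  sInf {t | 1 ≤ t ∧ ∀ S : Multiset G, t ≤ Multiset.card S →
    ∃ T, T ≤ S ∧ T ≠ 0 ∧ T.sum = 0}

/-- The constant `η(G)`. -/
noncomputable def etaConst (G : Type*) [AddCommGroup G] : ℕ :=
  sInf {t | 1 ≤ t ∧ ∀ S : Multiset G, t ≤ Multiset.card S →
    ∃ T, T ≤ S ∧ T ≠ 0 ∧ Multiset.card T ≤ AddMonoid.exponent G ∧ T.sum = 0}

/-- `υ_i(d',d) = A_i / gcd(A_i, B_i)` where `A_i = gcd(d', n_i)` and
`B_i = lcm(d, n_i)/lcm(d', n_i)`. -/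
def upsilon (ni d' d : ℕ) : ℕ :=
  Nat.gcd d' ni / Nat.gcd (Nat.gcd d' ni) (Nat.lcm d ni / Nat.lcm d' ni)

/-- `k*` of `C_{n_1} ⊕ ... ⊕ C_{n_r}`, computed from the primary decomposition. -/
noncomputable def kStarTuple {r : ℕ} (n : Fin r → ℕ) : ℝ :=
  ∑ i, ∑ p ∈ (n i).primeFactors,
    ((p ^ ((n i).factorization p) : ℝ) - 1) / (p ^ ((n i).factorization p))

/-- `α(n) = Σ_{d | n} (P⁻(d) − 1)/d`. -/
noncomputable def alphaFn (n : ℕ) : ℝ :=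
  ∑ d ∈ n.divisors, ((d.minFac : ℝ) - 1) / d

/-- `β(n) = Σ_{p | n prime} (p − 1)/p`. -/
noncomputable def betaFn (n : ℕ) : ℝ :=
  ∑ p ∈ n.primeFactors, ((p : ℝ) - 1) / p

theorem sum_norm_sq_addChar_sum {V β : Type*} [AddCommGroup V] [Fintype V]
    (B : Finset β) (h : β → V) :
    ∑ ψ : AddChar V ℂ, ‖∑ b ∈ B, ψ (h b)‖ ^ 2 =
      Fintype.card V * ∑ v, ((B.filter fun b => h b = v).card : ℝ) ^ 2 := by
  have key : ∀ ψ : AddChar V ℂ, ((‖∑ b ∈ B, ψ (h b)‖ ^ 2 : ℝ) : ℂ) =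
      ∑ b ∈ B, ∑ b' ∈ B, ψ (h b - h b') := by
    intro ψ
    rw [← Complex.normSq_eq_norm_sq, ← Complex.mul_conj, map_sum, Finset.sum_mul_sum]
    refine Finset.sum_congr rfl fun b _ => Finset.sum_congr rfl fun b' _ => ?_
    rw [← AddChar.map_neg_eq_conj, ← AddChar.map_add_eq_mul, sub_eq_add_neg]
  have hfib : ∀ b ∈ B, ∑ b' ∈ B, (if h b = h b' then (Fintype.card V : ℝ) else 0) =
      Fintype.card V * (B.filter fun b' => h b' = h b).card := by
    intro b _
    rw [← Finset.sum_filter, Finset.sum_const, nsmul_eq_mul, mul_comm]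
    simp only [eq_comm]
  apply Complex.ofReal_injective
  rw [Complex.ofReal_sum]
  simp_rw [key]
  rw [Finset.sum_comm]
  have : ∀ b ∈ B, ∑ ψ : AddChar V ℂ, ∑ b' ∈ B, ψ (h b - h b') =
      ((Fintype.card V * (B.filter fun b' => h b' = h b).card : ℝ) : ℂ) := by
    intro b hb
    rw [Finset.sum_comm, ← hfib b hb, Complex.ofReal_sum]
    refine Finset.sum_congr rfl fun b' _ => ?_
    rw [AddChar.sum_apply_eq_ite]
    simp only [sub_eq_zero]
    split_ifs <;> simp
  rw [Finset.sum_congr rfl this, ← Complex.ofReal_sum, ← Finset.mul_sum]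
  congr 2
  rw [← Finset.sum_fiberwise_of_maps_to (s := B) (t := Finset.univ) (g := h) (by simp)]
  refine Finset.sum_congr rfl fun v _ => ?_
  rw [Finset.sum_congr rfl (g := fun _ => ((B.filter fun b => h b = v).card : ℝ))]
  · rw [Finset.sum_const, nsmul_eq_mul, sq]
  · intro b hb
    rw [(Finset.mem_filter.1 hb).2]

theorem card_sq_le_card_image_mul_sum {V β : Type*} [Fintype V] (B : Finset β) (h : β → V) :
    (B.card : ℝ) ^ 2 ≤
      (B.image h).card * ∑ v, ((B.filter fun b => h b = v).card : ℝ) ^ 2 := by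
  have h1 : (B.card : ℝ) = ∑ v ∈ B.image h, ((B.filter fun b => h b = v).card : ℝ) := by
    exact_mod_cast Finset.card_eq_sum_card_image h B
  rw [h1]
  refine sq_sum_le_card_mul_sum_sq.trans ?_
  gcongr
  · exact Finset.subset_univ _

/-- The translates of `Y` by the first `k` multiples of `g` cover few points when `Y` is almost
invariant under translation by `g`. -/
theorem card_image_add_nsmul_le {V : Type*} [AddCommGroup V] (Y : Finset V) (g : V) (k : ℕ) :
    ((Y ×ˢ Finset.range k).image fun b => b.1 + b.2 • g).card ≤
      Y.card + k * ((Y.image (· + g)) \ Y).card := by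
  induction k with
  | zero => simp
  | succ k ih =>
    rcases Nat.eq_zero_or_pos k with rfl | hk
    · refine Finset.card_image_le.trans ?_
      simp
    · have hsub : ((Y ×ˢ Finset.range (k + 1)).image fun b => b.1 + b.2 • g) ⊆
          ((Y ×ˢ Finset.range k).image fun b => b.1 + b.2 • g) ∪
            (((Y.image (· + g)) \ Y).image (· + (k - 1) • g)) := by
        intro v hv
        simp only [Finset.mem_image, Finset.mem_product, Finset.mem_range, Prod.exists,
          Finset.mem_union, Finset.mem_sdiff] at hv ⊢
        obtain ⟨y, j, ⟨hy, hj⟩, rfl⟩ := hv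
        have hk' : (k - 1) • g + g = k • g := by
          rw [← succ_nsmul, Nat.sub_add_cancel hk]
        by_cases hjk : j < k
        · exact Or.inl ⟨y, j, ⟨hy, hjk⟩, rfl⟩
        · obtain rfl : j = k := by omega
          by_cases hyg : y + g ∈ Y
          · exact Or.inl ⟨y + g, j - 1, ⟨hyg, by omega⟩, by rw [add_assoc, add_comm g, hk']⟩
          · exact Or.inr ⟨y + g, ⟨⟨y, hy, rfl⟩, hyg⟩, by rw [add_assoc, add_comm g, hk']⟩
      calc _ ≤ _ := Finset.card_le_card hsub
        _ ≤ _ := Finset.card_union_le _ _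
        _ ≤ (Y.card + k * ((Y.image (· + g)) \ Y).card) + ((Y.image (· + g)) \ Y).card :=
          add_le_add ih Finset.card_image_le
        _ = _ := by ring

theorem sum_norm_sq_geom_sum_zmod (p k : ℕ) [NeZero p] (hk : k ≤ p) :
    ∑ χ : AddChar (ZMod p) ℂ, ‖∑ j ∈ Finset.range k, χ 1 ^ j‖ ^ 2 = p * k := by
  have h := sum_norm_sq_addChar_sum (V := ZMod p) (Finset.range k) (fun j => (j : ZMod p))
  have e : ∀ χ : AddChar (ZMod p) ℂ, ∑ j ∈ Finset.range k, χ (j : ZMod p) =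
      ∑ j ∈ Finset.range k, χ 1 ^ j := by
    intro χ
    refine Finset.sum_congr rfl fun j _ => ?_
    rw [← AddChar.map_nsmul_eq_pow, nsmul_one]
  simp_rw [e] at h
  rw [h, ZMod.card]
  congr 1
  have hinj : ∀ v : ZMod p, ((Finset.range k).filter fun j : ℕ => (j : ZMod p) = v).card ≤ 1 := by
    intro v
    rw [Finset.card_le_one]
    intro a ha b hb
    simp only [Finset.mem_filter, Finset.mem_range] at ha hb
    have := (ZMod.natCast_eq_natCast_iff' a b p).1 (ha.2.trans hb.2.symm)
    rwa [Nat.mod_eq_of_lt (by omega), Nat.mod_eq_of_lt (by omega)] at this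
  have hsq : ∀ v : ZMod p, (((Finset.range k).filter fun j : ℕ => (j : ZMod p) = v).card : ℝ) ^ 2 =
      ((Finset.range k).filter fun j : ℕ => (j : ZMod p) = v).card := by
    intro v
    have := hinj v
    interval_cases ((Finset.range k).filter fun j : ℕ => (j : ZMod p) = v).card <;> simp
  have := Finset.card_eq_sum_card_fiberwise (s := Finset.range k) (t := Finset.univ)
    (f := fun j : ℕ => (j : ZMod p)) (by simp)
  rw [Finset.card_range] at this
  have hsum : ∑ v : ZMod p,
      (((Finset.range k).filter fun j : ℕ => (j : ZMod p) = v).card : ℝ) ^ 2 = k := by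
    rw [Finset.sum_congr rfl fun v _ => hsq v]
    exact_mod_cast this.symm
  convert hsum

theorem sum_norm_sq_geom_sum_le {ι : Type*} (p k : ℕ) [NeZero p] (hk : k ≤ p) (B : Finset ι)
    (z : ι → ℂ) (hz : ∀ i ∈ B, z i ^ p = 1) (c : ℝ)
    (hB : ∀ w, ((B.filter fun i => z i = w).card : ℝ) ≤ c) :
    ∑ i ∈ B, ‖∑ j ∈ Finset.range k, z i ^ j‖ ^ 2 ≤ c * (p * k) := by
  have : ∀ i, ∃ χ : AddChar (ZMod p) ℂ, i ∈ B → χ 1 = z i := by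
    intro i
    by_cases hi : i ∈ B
    · exact ⟨AddChar.zmodChar p (hz i hi), fun _ => by
        simpa using AddChar.zmodChar_apply' (hz i hi) 1⟩
    · exact ⟨0, fun h => absurd h hi⟩
  choose χ hχ using this
  rw [← sum_norm_sq_geom_sum_zmod p k hk, Finset.mul_sum,
    ← Finset.sum_fiberwise_of_maps_to (s := B) (t := Finset.univ) (g := χ) (by simp)]
  refine Finset.sum_le_sum fun θ _ => ?_
  rw [Finset.sum_congr rfl (g := fun _ => ‖∑ j ∈ Finset.range k, θ 1 ^ j‖ ^ 2), Finset.sum_const,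
    nsmul_eq_mul]
  · refine mul_le_mul_of_nonneg_right (le_trans ?_ (hB (θ 1))) (by positivity)
    exact_mod_cast Finset.card_le_card fun i hi => by
      simp only [Finset.mem_filter] at hi ⊢
      exact ⟨hi.1, by rw [← hχ i hi.1, hi.2]⟩
  · intro i hi
    simp only [Finset.mem_filter] at hi
    rw [← hχ i hi.1, hi.2]

/-- A spread-out family of translations expands every set of density at most one half. -/
theorem exists_card_le_mul_card_translate_sdiff {V ι : Type*} [AddCommGroup V] [Fintype V]
    {p k : ℕ} (hp : 0 < p) (hk0 : 0 < k) (hk : k ≤ p) (hV : ∀ v : V, p • v = 0) (Y : Finset V)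
    (hY : 2 * Y.card ≤ Fintype.card V) (B : Finset ι) (hB0 : B.Nonempty) (g : ι → V)
    (hB : ∀ ψ : AddChar V ℂ, ψ ≠ 0 → ∀ z : ℂ,
      4 * p * (B.filter fun i => ψ (g i) = z).card ≤ k * B.card) :
    ∃ i ∈ B, Y.card ≤ 4 * k * ((Y.image (· + g i)) \ Y).card := by
  have : NeZero p := ⟨hp.ne'⟩
  by_contra! hcon
  obtain ⟨i₀, hi₀⟩ := hB0
  have hYpos : 0 < Y.card := lt_of_le_of_lt (Nat.zero_le _) (hcon i₀ hi₀)
  have hy : (0 : ℝ) < Y.card := by exact_mod_cast hYpos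
  have hkr : (0 : ℝ) < k := by exact_mod_cast hk0
  have hb : (0 : ℝ) < B.card := by exact_mod_cast Finset.card_pos.2 ⟨i₀, hi₀⟩
  have hv : (2 : ℝ) * Y.card ≤ Fintype.card V := by exact_mod_cast hY
  have hpr : (0 : ℝ) < p := by exact_mod_cast hp
  have hfac : ∀ (ψ : AddChar V ℂ) (i : ι),
      ‖∑ b ∈ Y ×ˢ Finset.range k, ψ (b.1 + b.2 • g i)‖ ^ 2 =
        ‖∑ y ∈ Y, ψ y‖ ^ 2 * ‖∑ j ∈ Finset.range k, ψ (g i) ^ j‖ ^ 2 := by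
    intro ψ i
    rw [← mul_pow, ← norm_mul, Finset.sum_mul_sum, Finset.sum_product]
    simp only [AddChar.map_add_eq_mul, AddChar.map_nsmul_eq_pow]
  have hlow : ∀ i ∈ B, (4 / 5 : ℝ) * k ^ 2 * Y.card * Fintype.card V ≤
      ∑ ψ : AddChar V ℂ, ‖∑ b ∈ Y ×ˢ Finset.range k, ψ (b.1 + b.2 • g i)‖ ^ 2 := by
    intro i hi
    rw [sum_norm_sq_addChar_sum]
    have h1 := card_sq_le_card_image_mul_sum (Y ×ˢ Finset.range k) fun b => b.1 + b.2 • g i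
    have h2 : (((Y ×ˢ Finset.range k).image fun b => b.1 + b.2 • g i).card : ℝ) ≤
        Y.card + k * ((Y.image (· + g i)) \ Y).card := by
      exact_mod_cast card_image_add_nsmul_le Y (g i) k
    have h3 : (4 : ℝ) * k * ((Y.image (· + g i)) \ Y).card < Y.card := by
      exact_mod_cast hcon i hi
    set E : ℝ := ∑ v, (((Y ×ˢ Finset.range k).filter
      fun b => b.1 + b.2 • g i = v).card : ℝ) ^ 2 with hE
    have hE0 : 0 ≤ E := Finset.sum_nonneg fun _ _ => by positivity
    have h4 : (Y.card * k : ℝ) ^ 2 ≤ (5 / 4 * Y.card) * E := by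
      rw [Finset.card_product, Finset.card_range] at h1
      push_cast at h1
      exact h1.trans (mul_le_mul_of_nonneg_right (by linarith) hE0)
    have h5 : (4 / 5 : ℝ) * k ^ 2 * Y.card ≤ E := by
      have : (Y.card : ℝ) * ((4 / 5 : ℝ) * k ^ 2 * Y.card) ≤ Y.card * E := by linarith
      exact le_of_mul_le_mul_left this hy
    have h0 : (0 : ℝ) ≤ Fintype.card V := by positivity
    linarith [mul_le_mul_of_nonneg_left h5 h0]
  have hsum := Finset.sum_le_sum hlow
  rw [Finset.sum_const, nsmul_eq_mul, Finset.sum_comm] at hsum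
  simp_rw [hfac, ← Finset.mul_sum] at hsum
  have hpars : ∑ ψ : AddChar V ℂ, ‖∑ y ∈ Y, ψ y‖ ^ 2 = Fintype.card V * Y.card := by
    have := sum_norm_sq_addChar_sum Y (id : V → V)
    simp only [id] at this
    rw [this]
    congr 1
    have : ∀ v : V, ((Y.filter fun b => b = v).card : ℝ) ^ 2 = if v ∈ Y then 1 else 0 := by
      intro v
      split_ifs with hvY
      · rw [show (Y.filter fun b => b = v) = {v} by ext; aesop]
        simp
      · rw [show (Y.filter fun b => b = v) = ∅ by ext; aesop]
        simp
    simp_rw [this]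
    simp
  have htriv : ‖∑ y ∈ Y, (0 : AddChar V ℂ) y‖ ^ 2 = (Y.card : ℝ) ^ 2 := by simp
  have hker : ∀ ψ : AddChar V ℂ, ψ ≠ 0 →
      ∑ i ∈ B, ‖∑ j ∈ Finset.range k, ψ (g i) ^ j‖ ^ 2 ≤ k ^ 2 * B.card / 4 := by
    intro ψ hψ
    refine (sum_norm_sq_geom_sum_le p k hk B (fun i => ψ (g i)) (fun i _ => ?_)
      (k * B.card / (4 * p)) fun w => ?_).trans ?_
    · rw [← AddChar.map_nsmul_eq_pow, hV, AddChar.map_zero_eq_one]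
    · rw [le_div_iff₀ (by positivity)]
      have := hB ψ hψ w
      have : (4 : ℝ) * p * (B.filter fun i => ψ (g i) = w).card ≤ k * B.card := by
        exact_mod_cast this
      linarith
    · apply le_of_eq
      field_simp
  have hker0 : ∑ i ∈ B, ‖∑ j ∈ Finset.range k, (0 : AddChar V ℂ) (g i) ^ j‖ ^ 2 =
      k ^ 2 * B.card := by
    simp [mul_comm]
  rw [← Finset.add_sum_erase _ _ (Finset.mem_univ (0 : AddChar V ℂ)), htriv] at hpars
  rw [← Finset.add_sum_erase _ _ (Finset.mem_univ (0 : AddChar V ℂ)), htriv, hker0] at hsum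
  have hnon : ∑ ψ ∈ Finset.univ.erase (0 : AddChar V ℂ), ‖∑ y ∈ Y, ψ y‖ ^ 2 *
      ∑ i ∈ B, ‖∑ j ∈ Finset.range k, ψ (g i) ^ j‖ ^ 2 ≤
      (∑ ψ ∈ Finset.univ.erase (0 : AddChar V ℂ), ‖∑ y ∈ Y, ψ y‖ ^ 2) *
        (k ^ 2 * B.card / 4) := by
    rw [Finset.sum_mul]
    refine Finset.sum_le_sum fun ψ hψ => mul_le_mul_of_nonneg_left
      (hker ψ (Finset.ne_of_mem_erase hψ)) (by positivity)
  have hE : ∑ ψ ∈ Finset.univ.erase (0 : AddChar V ℂ), ‖∑ y ∈ Y, ψ y‖ ^ 2 =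
      Fintype.card V * Y.card - (Y.card : ℝ) ^ 2 := by linarith
  rw [hE] at hnon
  have hfin : (B.card : ℝ) * k ^ 2 * (4 / 5 * Y.card * Fintype.card V) ≤
      B.card * k ^ 2 * (Y.card ^ 2 + (Fintype.card V * Y.card - (Y.card : ℝ) ^ 2) / 4) := by
    linarith
  have hfin' := le_of_mul_le_mul_left hfin (by positivity)
  nlinarith [mul_pos hy hy]

theorem exists_half_cover_or_growth {V ι : Type*} [AddCommGroup V] [Fintype V] {p k s : ℕ}
    (hp : 0 < p) (hk0 : 0 < k) (hk : k ≤ p) (hV : ∀ v : V, p • v = 0) (f : ι → V) (A : Finset ι)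
    (hA : ∀ ψ : AddChar V ℂ, ψ ≠ 0 → ∀ z : ℂ, (A.filter fun i => ψ (f i) = z).card ≤ s) (t : ℕ)
    (ht : 2 * t ≤ A.card) (hs : 4 * p * s ≤ k * (A.card - 2 * t)) :
    ∃ U ⊆ A, U.card = 2 * t ∧ ∃ Y : Finset V,
      (∀ y ∈ Y, ∃ T ⊆ U, T.card = t ∧ ∑ i ∈ T, f i = y) ∧
      (Fintype.card V < 2 * Y.card ∨ (4 * k + 1) ^ t ≤ (4 * k) ^ t * Y.card) := by
  induction t with
  | zero =>
    exact ⟨∅, by simp, by simp, {0}, fun y hy => ⟨∅, by simp_all⟩, Or.inr (by simp)⟩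
  | succ t ih =>
    obtain ⟨U, hUA, hU, Y, hY, hgr⟩ := ih (by omega)
      (hs.trans (Nat.mul_le_mul_left _ (by omega)))
    have hcard : (A \ U).card = A.card - 2 * t := by rw [Finset.card_sdiff_of_subset hUA, hU]
    obtain ⟨b₀, hb₀⟩ : (A \ U).Nonempty := Finset.card_pos.1 (by omega)
    have hcard' : ((A \ U).erase b₀).card = A.card - 2 * t - 1 := by
      rw [Finset.card_erase_of_mem hb₀, hcard]
    have hne : ((A \ U).erase b₀).Nonempty := Finset.card_pos.1 (by omega)
    have hpair : ∃ b ∈ (A \ U).erase b₀, Fintype.card V < 2 * Y.card ∨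
        Y.card ≤ 4 * k * ((Y.image (· + (f b - f b₀))) \ Y).card := by
      by_cases hbig : Fintype.card V < 2 * Y.card
      · obtain ⟨b, hb⟩ := hne
        exact ⟨b, hb, Or.inl hbig⟩
      · obtain ⟨b, hb, h⟩ := exists_card_le_mul_card_translate_sdiff hp hk0 hk hV Y
          (by omega) ((A \ U).erase b₀) hne (fun i => f i - f b₀) fun ψ hψ z => by
            refine le_trans (Nat.mul_le_mul_left _ ?_)
              (hs.trans (Nat.mul_le_mul_left _ (by omega)))
            refine (Finset.card_le_card fun i hi => ?_).trans (hA ψ hψ (z * ψ (f b₀)))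
            simp only [Finset.mem_filter, Finset.mem_erase, Finset.mem_sdiff] at hi ⊢
            refine ⟨hi.1.2.1, ?_⟩
            rw [← hi.2, ← AddChar.map_add_eq_mul, sub_add_cancel]
        exact ⟨b, hb, Or.inr h⟩
    obtain ⟨b, hb, hbY⟩ := hpair
    simp only [Finset.mem_erase, Finset.mem_sdiff] at hb hb₀
    have himg : (Y.image (· + f b₀) ∪ Y.image (· + f b)).card =
        Y.card + ((Y.image (· + (f b - f b₀))) \ Y).card := by
      have : Y.image (· + f b₀) ∪ Y.image (· + f b) =
          (Y ∪ ((Y.image (· + (f b - f b₀))) \ Y)).image (· + f b₀) := by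
        rw [Finset.union_sdiff_self_eq_union, Finset.image_union, Finset.image_image]
        congr 2
        ext v
        simp [add_assoc]
      rw [this, Finset.card_image_of_injective _ (add_left_injective _),
        Finset.card_union_of_disjoint Finset.disjoint_sdiff]
    refine ⟨insert b (insert b₀ U), ?_, ?_, Y.image (· + f b₀) ∪ Y.image (· + f b), ?_, ?_⟩
    · intro i hi
      simp only [Finset.mem_insert] at hi
      rcases hi with rfl | rfl | hi
      exacts [hb.2.1, hb₀.1, hUA hi]
    · rw [Finset.card_insert_of_notMem, Finset.card_insert_of_notMem hb₀.2, hU]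
      · ring
      · simp only [Finset.mem_insert, not_or]
        exact ⟨hb.1, hb.2.2⟩
    · intro y hy
      simp only [Finset.mem_union, Finset.mem_image] at hy
      rcases hy with ⟨y', hy', rfl⟩ | ⟨y', hy', rfl⟩
      · obtain ⟨T, hTU, hT, hTs⟩ := hY y' hy'
        refine ⟨insert b₀ T, ?_, ?_, ?_⟩
        · exact (Finset.insert_subset_insert _ hTU).trans (Finset.subset_insert _ _)
        · rw [Finset.card_insert_of_notMem fun h => hb₀.2 (hTU h), hT]
        · rw [Finset.sum_insert fun h => hb₀.2 (hTU h), hTs, add_comm]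
      · obtain ⟨T, hTU, hT, hTs⟩ := hY y' hy'
        refine ⟨insert b T, ?_, ?_, ?_⟩
        · exact Finset.insert_subset_insert _ (hTU.trans (Finset.subset_insert _ _))
        · rw [Finset.card_insert_of_notMem fun h => hb.2.2 (hTU h), hT]
        · rw [Finset.sum_insert fun h => hb.2.2 (hTU h), hTs, add_comm]
    · rw [himg]
      by_cases hbig : Fintype.card V < 2 * Y.card
      · exact Or.inl (by omega)
      · refine Or.inr ?_
        have h1 := hgr.resolve_left hbig
        have h2 := hbY.resolve_left hbig
        calc (4 * k + 1) ^ (t + 1) = (4 * k + 1) ^ t * (4 * k + 1) := pow_succ _ _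
          _ ≤ (4 * k) ^ t * Y.card * (4 * k + 1) := Nat.mul_le_mul_right _ h1
          _ = (4 * k) ^ t * (4 * k * Y.card + Y.card) := by ring
          _ ≤ (4 * k) ^ t * (4 * k * Y.card +
              4 * k * ((Y.image (· + (f b - f b₀))) \ Y).card) := by gcongr
          _ = _ := by ring

theorem two_mul_pow_self_le_succ_pow {a : ℕ} (ha : 0 < a) : 2 * a ^ a ≤ (a + 1) ^ a := by
  obtain ⟨b, rfl⟩ : ∃ b, a = b + 1 := ⟨a - 1, by omega⟩
  rw [add_pow (b + 1) 1 (b + 1), Finset.sum_range_succ, Finset.sum_range_succ]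
  simp only [one_pow, mul_one, Nat.choose_self, Nat.cast_id]
  have : (b + 1) ^ b * (b + 1).choose b = (b + 1) ^ (b + 1) := by
    rw [Nat.choose_succ_self_right, pow_succ]
  omega

/-- If no affine hyperplane contains many terms, then sums of exactly `p` terms reach zero. -/
theorem exists_zero_sum_of_spread {V ι : Type*} [AddCommGroup V] [Fintype V] {p k s t : ℕ}
    (hp : 0 < p) (hk0 : 0 < k) (hk : k ≤ p) (hV : ∀ v : V, p • v = 0) (f : ι → V) (A : Finset ι)
    (hA : ∀ ψ : AddChar V ℂ, ψ ≠ 0 → ∀ z : ℂ, (A.filter fun i => ψ (f i) = z).card ≤ s)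
    (ht : 2 * t ≤ p) (hcard : 3 * p ≤ A.card) (hs : 4 * p * s ≤ k * (A.card - 2 * p))
    (hgrow : Fintype.card V * (4 * k) ^ t < (4 * k + 1) ^ t) :
    ∃ T ⊆ A, T.card = p ∧ ∑ i ∈ T, f i = 0 := by
  have hlarge : ∀ Y : Finset V,
      (Fintype.card V < 2 * Y.card ∨ (4 * k + 1) ^ t ≤ (4 * k) ^ t * Y.card) →
      Fintype.card V < 2 * Y.card := by
    rintro Y (h | h)
    · exact h
    · have h1 : Fintype.card V * (4 * k) ^ t < Y.card * (4 * k) ^ t := by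
        rw [mul_comm Y.card]
        exact hgrow.trans_le h
      have := lt_of_mul_lt_mul_right h1 (Nat.zero_le _)
      omega
  obtain ⟨U₁, hU₁, hc₁, Y₁, hY₁, hg₁⟩ := exists_half_cover_or_growth hp hk0 hk hV f A hA t
    (by omega) (hs.trans (Nat.mul_le_mul_left _ (by omega)))
  have hcA : (A \ U₁).card = A.card - 2 * t := by rw [Finset.card_sdiff_of_subset hU₁, hc₁]
  obtain ⟨U₂, hU₂, hc₂, Y₂, hY₂, hg₂⟩ := exists_half_cover_or_growth hp hk0 hk hV f (A \ U₁)
    (fun ψ hψ z => (Finset.card_le_card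
      (Finset.filter_subset_filter _ Finset.sdiff_subset)).trans (hA ψ hψ z)) t
    (by omega) (hs.trans (Nat.mul_le_mul_left _ (by omega)))
  have hcA' : ((A \ U₁) \ U₂).card = A.card - 2 * t - 2 * t := by
    rw [Finset.card_sdiff_of_subset hU₂, hc₂, hcA]
  obtain ⟨W, hW, hcW⟩ := Finset.exists_subset_card_eq (s := (A \ U₁) \ U₂) (n := p - 2 * t)
    (by omega)
  have h₁ := hlarge _ hg₁
  have h₂ := hlarge _ hg₂
  set c := ∑ i ∈ W, f i
  have hmeet : ¬ Disjoint Y₁ (Y₂.image fun y => -c - y) := by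
    intro hd
    have := Finset.card_le_univ (Y₁ ∪ Y₂.image fun y => -c - y)
    rw [Finset.card_union_of_disjoint hd, Finset.card_image_of_injective _ sub_right_injective]
      at this
    omega
  obtain ⟨y, hy, hy'⟩ := Finset.not_disjoint_iff.1 hmeet
  obtain ⟨y₂, hy₂, rfl⟩ := Finset.mem_image.1 hy'
  obtain ⟨T₁, hT₁, hn₁, hs₁⟩ := hY₁ _ hy
  obtain ⟨T₂, hT₂, hn₂, hs₂⟩ := hY₂ _ hy₂
  have hd12 : Disjoint T₁ T₂ := by
    rw [Finset.disjoint_left]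
    intro i h1 h2
    exact (Finset.mem_sdiff.1 (hU₂ (hT₂ h2))).2 (hT₁ h1)
  have hd3 : Disjoint (T₁ ∪ T₂) W := by
    rw [Finset.disjoint_left]
    intro i h1 h2
    have h3 := Finset.mem_sdiff.1 (hW h2)
    rcases Finset.mem_union.1 h1 with h1 | h1
    · exact (Finset.mem_sdiff.1 h3.1).2 (hT₁ h1)
    · exact h3.2 (hT₂ h1)
  refine ⟨T₁ ∪ T₂ ∪ W, ?_, ?_, ?_⟩
  · refine Finset.union_subset (Finset.union_subset (hT₁.trans hU₁)
      ((hT₂.trans hU₂).trans Finset.sdiff_subset)) ?_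
    exact (hW.trans Finset.sdiff_subset).trans Finset.sdiff_subset
  · rw [Finset.card_union_of_disjoint hd3, Finset.card_union_of_disjoint hd12]
    omega
  · rw [Finset.sum_union hd3, Finset.sum_union hd12, hs₁, hs₂]
    simp [c]

/-- The kernel of an additive character. -/
def addCharKer {V : Type*} [AddCommGroup V] (ψ : AddChar V ℂ) : AddSubgroup V where
  carrier := {v | ψ v = 1}
  zero_mem' := AddChar.map_zero_eq_one ψ
  add_mem' {a b} ha hb := by
    simp only [Set.mem_ofPred_eq] at *
    rw [AddChar.map_add_eq_mul, ha, hb, one_mul]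
  neg_mem' {a} ha := by
    simp only [Set.mem_ofPred_eq] at *
    rw [AddChar.map_neg_eq_inv, ha, inv_one]

theorem card_addCharKer_mul_le {V : Type*} [AddCommGroup V] [Fintype V] {p : ℕ}
    (hp : p.Prime) (hV : ∀ v : V, p • v = 0) {ψ : AddChar V ℂ} (hψ : ψ ≠ 0) :
    Nat.card (addCharKer ψ) * p ≤ Nat.card V := by
  obtain ⟨v, hv⟩ := (AddChar.ne_zero_iff).1 hψ
  rw [← (addCharKer ψ).card_mul_index]
  refine Nat.mul_le_mul_left _ (Nat.le_of_dvd (Nat.pos_of_ne_zero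
    AddSubgroup.index_ne_zero_of_finite) ?_)
  have : Fact p.Prime := ⟨hp⟩
  have h1 : addOrderOf (QuotientAddGroup.mk v : V ⧸ addCharKer ψ) = p := by
    refine addOrderOf_eq_prime ?_ ?_
    · rw [← QuotientAddGroup.mk_nsmul, hV, QuotientAddGroup.mk_zero]
    · rw [Ne, QuotientAddGroup.eq_zero_iff]
      exact hv
  rw [← h1]
  exact addOrderOf_dvd_natCard _

/-- A weak form of the Alon-Dubiner theorem: over an elementary abelian `p`-group of rank at most
`r`, every sequence of length at least `p * (128 * r * (log₂ p + 1)) ^ r` has a zero-sum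
subsequence of length `p`. -/
theorem exists_zero_sum_of_elementary {p r : ℕ} (hp : p.Prime) (e : ℕ) (he : e ≤ r) {ι : Type*} :
    ∀ {V : Type*} [AddCommGroup V] [Fintype V], (∀ v : V, p • v = 0) →
      Fintype.card V ≤ p ^ e → ∀ (f : ι → V) (A : Finset ι),
      p * (128 * r * (Nat.log 2 p + 1)) ^ e ≤ A.card →
      ∃ T ⊆ A, T.card = p ∧ ∑ i ∈ T, f i = 0 := by
  induction e with
  | zero =>
    intro V _ _ hV hcV f A hA
    obtain ⟨T, hT, hc⟩ := Finset.exists_subset_card_eq (s := A) (n := p) (by simpa using hA)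
    have : Subsingleton V := Fintype.card_le_one_iff_subsingleton.1 (by simpa using hcV)
    exact ⟨T, hT, hc, Subsingleton.elim _ _⟩
  | succ e ih =>
    intro V _ _ hV hcV f A hA
    have hr : 0 < r := by omega
    set l := Nat.log 2 p + 1 with hl
    set X := 128 * r * l with hX
    have hrl : 0 < r * l := Nat.mul_pos hr (by omega)
    have hXpos : 128 ≤ X := by rw [hX, mul_assoc]; omega
    have hXe : 0 < X ^ e := by positivity
    by_cases hconc : ∃ ψ : AddChar V ℂ, ψ ≠ 0 ∧ ∃ z, p * X ^ e <
        (A.filter fun i => ψ (f i) = z).card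
    · obtain ⟨ψ, hψ, z, hz⟩ := hconc
      set B := A.filter fun i => ψ (f i) = z with hB
      obtain ⟨a, ha⟩ : B.Nonempty := Finset.card_pos.1 (by omega)
      have hza : ψ (f a) = z := (Finset.mem_filter.1 ha).2
      have hker : ∀ i ∈ B, f i - f a ∈ addCharKer ψ := by
        intro i hi
        change ψ (f i - f a) = 1
        have h1 : ψ (f i) = z := (Finset.mem_filter.1 hi).2
        have h2 : ψ (f a) ≠ 0 := by
          rw [← norm_ne_zero_iff, AddChar.norm_apply]
          exact one_ne_zero
        have : ψ (f i - f a) * ψ (f a) = ψ (f a) := by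
          rw [← AddChar.map_add_eq_mul, sub_add_cancel, h1, hza]
        exact mul_right_cancel₀ h2 (by rw [this, one_mul])
      have hcK : Fintype.card (addCharKer ψ) ≤ p ^ e := by
        have := card_addCharKer_mul_le hp hV hψ
        rw [Nat.card_eq_fintype_card, Nat.card_eq_fintype_card] at this
        exact Nat.le_of_mul_le_mul_right ((this.trans hcV).trans (pow_succ p e).le) hp.pos
      obtain ⟨T, hT, hc, hs⟩ := ih (by omega) (V := addCharKer ψ)
        (fun v => Subtype.ext (by simpa using hV v.1)) hcK
        (fun i => if h : i ∈ B then ⟨f i - f a, hker i h⟩ else 0) B hz.le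
      refine ⟨T, hT.trans (Finset.filter_subset _ _), hc, ?_⟩
      have hs' := congrArg (addCharKer ψ).subtype hs
      rw [map_sum, map_zero] at hs'
      have : ∑ i ∈ T, (f i - f a) = 0 := by
        rw [← hs']
        refine Finset.sum_congr rfl fun i hi => ?_
        simp [hT hi]
      rwa [Finset.sum_sub_distrib, Finset.sum_const, hc, hV, sub_zero] at this
    · push Not at hconc
      have hple : p < 2 ^ l := Nat.lt_pow_succ_log_self (by norm_num) p
      set k := p / (8 * (r * l)) with hk
      rcases Nat.eq_zero_or_pos k with hk0 | hk0
      · have hpX : p ≤ X := by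
          rw [hk, Nat.div_eq_zero_iff] at hk0
          rw [hX, mul_assoc]
          omega
        have hcA : Fintype.card V * p ≤ A.card := by
          refine le_trans ?_ hA
          rw [mul_comm]
          exact Nat.mul_le_mul_left _ (hcV.trans (Nat.pow_le_pow_left hpX _))
        obtain ⟨v, -, hv⟩ := Finset.exists_le_card_fiber_of_mul_le_card_of_maps_to
          (s := A) (t := Finset.univ) (f := f) (n := p) (by simp) ⟨0, by simp⟩
          (by simpa using hcA)
        obtain ⟨T, hT, hc⟩ := Finset.exists_subset_card_eq hv
        refine ⟨T, hT.trans (Finset.filter_subset _ _), hc, ?_⟩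
        rw [Finset.sum_congr rfl fun i hi => (Finset.mem_filter.1 (hT hi)).2,
          Finset.sum_const, hc, hV]
      · have hk8 : 8 * (r * l) * k ≤ p := Nat.mul_div_le _ _
        have hk16 : p ≤ 16 * (r * l) * k := by
          have h1 : p < 8 * (r * l) * (k + 1) := Nat.lt_mul_div_succ _ (by omega)
          have h2 : r * l ≤ r * l * k := Nat.le_mul_of_pos_right _ hk0
          nlinarith
        have hkp : k ≤ p := Nat.div_le_self _ _
        have hpA : 128 * p ≤ A.card := by
          refine le_trans ?_ hA
          rw [mul_comm, pow_succ]
          exact Nat.mul_le_mul_left _ (hXpos.trans (Nat.le_mul_of_pos_left _ hXe))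
        refine exists_zero_sum_of_spread (t := 4 * k * (r * l)) hp.pos hk0 hkp hV f A hconc
          (by nlinarith) (by omega) ?_ ?_
        · have h1 : A.card ≤ 2 * (A.card - 2 * p) := by omega
          have h2 : 8 * p ≤ k * X := by rw [hX]; nlinarith
          have h3 : 8 * p * (p * X ^ e) ≤ 2 * (k * (A.card - 2 * p)) :=
            calc 8 * p * (p * X ^ e) ≤ k * X * (p * X ^ e) := Nat.mul_le_mul_right _ h2
              _ = k * (p * X ^ (e + 1)) := by ring
              _ ≤ k * A.card := Nat.mul_le_mul_left _ hA
              _ ≤ k * (2 * (A.card - 2 * p)) := Nat.mul_le_mul_left _ h1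
              _ = _ := by ring
          linarith
        · have h1 : Fintype.card V < 2 ^ (r * l) :=
            calc Fintype.card V ≤ p ^ (e + 1) := hcV
              _ ≤ p ^ r := Nat.pow_le_pow_right hp.pos he
              _ < (2 ^ l) ^ r := Nat.pow_lt_pow_left hple hr.ne'
              _ = 2 ^ (r * l) := by rw [← pow_mul, mul_comm]
          calc Fintype.card V * (4 * k) ^ (4 * k * (r * l))
              < 2 ^ (r * l) * (4 * k) ^ (4 * k * (r * l)) :=
                Nat.mul_lt_mul_of_pos_right h1 (by positivity)
            _ = (2 * (4 * k) ^ (4 * k)) ^ (r * l) := by rw [mul_pow 2, ← pow_mul (4 * k)]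
            _ ≤ ((4 * k + 1) ^ (4 * k)) ^ (r * l) :=
                Nat.pow_le_pow_left (two_mul_pow_self_le_succ_pow (by omega)) _
            _ = _ := by rw [← pow_mul]

theorem exists_disjoint_family {ι : Type*} {L m : ℕ} (hm : 0 < m) (P : Finset ι → Prop)
    (A : Finset ι) (h : ∀ B ⊆ A, L ≤ B.card → ∃ T ⊆ B, T.card = m ∧ P T) :
    ∃ 𝒯 : Finset (Finset ι), (∀ T ∈ 𝒯, T ⊆ A ∧ T.card = m ∧ P T) ∧
      (𝒯 : Set (Finset ι)).PairwiseDisjoint id ∧ A.card ≤ L + m * 𝒯.card := by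
  induction hn : A.card using Nat.strong_induction_on generalizing A with
  | _ n ih =>
    by_cases hL : L ≤ A.card
    · obtain ⟨T, hTA, hT, hPT⟩ := h A subset_rfl hL
      have hTpos : 0 < T.card := hT ▸ hm
      have hcard : (A \ T).card + T.card = A.card := Finset.card_sdiff_add_card_eq_card hTA
      obtain ⟨𝒯, h1, h2, h3⟩ := ih (A \ T).card (by omega) (A \ T)
        (fun B hB => h B (hB.trans Finset.sdiff_subset)) rfl
      have hnot : T ∉ 𝒯 := by
        intro hmem
        obtain ⟨x, hx⟩ := Finset.card_pos.1 hTpos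
        exact (Finset.mem_sdiff.1 ((h1 T hmem).1 hx)).2 hx
      refine ⟨insert T 𝒯, ?_, ?_, ?_⟩
      · intro T' hT'
        rcases Finset.mem_insert.1 hT' with rfl | hT'
        · exact ⟨hTA, hT, hPT⟩
        · exact ⟨(h1 T' hT').1.trans Finset.sdiff_subset, (h1 T' hT').2⟩
      · rw [Finset.coe_insert]
        refine h2.insert fun T' hT' _ => ?_
        exact Finset.disjoint_of_subset_right (h1 T' hT').1 Finset.disjoint_sdiff
      · rw [Finset.card_insert_of_notMem hnot, mul_add]
        omega
    · exact ⟨∅, by simp, by simp, by omega⟩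

/-- Zero-sum subsequences of length `m` in the `m`-torsion of a finite abelian group whose
elementary subgroups have bounded rank. -/
theorem exists_zero_sum_of_torsion {G : Type*} [AddCommGroup G] [Finite G] {r F : ℕ} (hF : 1 ≤ F)
    (m : ℕ) (hm : m ≠ 0)
    (hrank : ∀ q : ℕ, q.Prime → q ∣ m → Nat.card (nsmulAddMonoidHom (α := G) q).ker ≤ q ^ r)
    (hFq : ∀ q : ℕ, q.Prime → q ∣ m → (128 * r * (Nat.log 2 q + 1)) ^ r ≤ F) :
    ∀ {ι : Type*} (f : ι → G) (A : Finset ι), (∀ i ∈ A, m • f i = 0) →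
      3 * F * m ≤ A.card + 2 * F → ∃ T ⊆ A, T.card = m ∧ ∑ i ∈ T, f i = 0 := by
  induction m using induction_on_primes with
  | zero => exact absurd rfl hm
  | one =>
    intro ι f A hA hcard
    obtain ⟨i, hi⟩ : A.Nonempty := Finset.card_pos.1 (by omega)
    exact ⟨{i}, by simpa using hi, by simp, by simpa using hA i hi⟩
  | prime_mul q m hq ih =>
    intro ι f A hA hcard
    have hm0 : m ≠ 0 := fun h => hm (by simp [h])
    have : Fintype (nsmulAddMonoidHom (α := G) q).ker := Fintype.ofFinite _
    have hext : ∀ B ⊆ A, q * F ≤ B.card → ∃ T ⊆ B, T.card = q ∧ m • ∑ i ∈ T, f i = 0 := by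
      intro B hB hBc
      have hmem : ∀ i ∈ B, m • f i ∈ (nsmulAddMonoidHom (α := G) q).ker := by
        intro i hi
        rw [AddMonoidHom.mem_ker, nsmulAddMonoidHom_apply, ← mul_nsmul', hA i (hB hi)]
      obtain ⟨T, hT, hc, hs⟩ := exists_zero_sum_of_elementary hq r le_rfl
        (V := (nsmulAddMonoidHom (α := G) q).ker)
        (fun v => Subtype.ext (AddMonoidHom.mem_ker.1 v.2))
        (by rw [← Nat.card_eq_fintype_card]; exact hrank q hq (dvd_mul_right _ _))
        (fun i => if h : i ∈ B then ⟨m • f i, hmem i h⟩ else 0) B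
        ((Nat.mul_le_mul_left _ (hFq q hq (dvd_mul_right _ _))).trans hBc)
      refine ⟨T, hT, hc, ?_⟩
      have hs' := congrArg (nsmulAddMonoidHom (α := G) q).ker.subtype hs
      rw [map_sum, map_zero] at hs'
      rw [← hs', Finset.smul_sum]
      refine Finset.sum_congr rfl fun i hi => ?_
      simp [hT hi]
    obtain ⟨𝒯, h1, h2, h3⟩ := exists_disjoint_family hq.pos _ A hext
    have hcard' : 3 * F * m ≤ 𝒯.card + 2 * F := by
      have hq2 := hq.two_le
      have : q * (3 * F * m) ≤ q * (𝒯.card + 2 * F) := by nlinarith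
      exact Nat.le_of_mul_le_mul_left this hq.pos
    obtain ⟨𝒰, hU, hUc, hUs⟩ := ih hm0 (fun q' h h' => hrank q' h (h'.mul_left _))
      (fun q' h h' => hFq q' h (h'.mul_left _)) (fun T : Finset ι => ∑ i ∈ T, f i) 𝒯
      (fun T hT => (h1 T hT).2.2) hcard'
    have hdisj : (𝒰 : Set (Finset ι)).PairwiseDisjoint id := h2.subset (by exact_mod_cast hU)
    refine ⟨𝒰.biUnion id, ?_, ?_, ?_⟩
    · exact Finset.biUnion_subset.2 fun T hT => (h1 T (hU hT)).1
    · have hsum : ∑ T ∈ 𝒰, (id T).card = ∑ _T ∈ 𝒰, q :=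
        Finset.sum_congr rfl fun T hT => (h1 T (hU hT)).2.1
      rw [Finset.card_biUnion hdisj, hsum]
      simp [hUc, mul_comm]
    · rw [Finset.sum_biUnion hdisj]
      exact hUs

theorem span_pow_mul_succ_eq_bot {R κ : Type*} [CommRing R] (x : κ → R) {P : ℕ} (s : Finset κ)
    (hx : ∀ i ∈ s, x i ^ P = 0) : Ideal.span (x '' s) ^ (s.card * P + 1) = ⊥ := by
  induction s using Finset.induction_on with
  | empty => simp
  | insert i s hi ih =>
    have h1 : Ideal.span {x i} ^ P = ⊥ := by
      rw [Ideal.span_singleton_pow, hx i (Finset.mem_insert_self _ _)]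
      simp
    have h2 := ih fun j hj => hx j (Finset.mem_insert_of_mem hj)
    have h3 : (insert i s).card * P + 1 = P + (s.card * P + 1) := by
      rw [Finset.card_insert_of_notMem hi]
      ring
    rw [h3, Finset.coe_insert, Set.image_insert_eq, Ideal.span_insert, eq_bot_iff]
    refine Ideal.sup_pow_add_le_pow_sup_pow.trans ?_
    rw [h1, h2, sup_bot_eq]

/-- In a zero-sumfree family the product of the elements `1 - X ^ g` of the group algebra does not
vanish. -/
theorem prod_one_sub_single_ne_zero {k G ι : Type*} [Field k] [AddCommGroup G] (f : ι → G)
    (A : Finset ι) (hA : ∀ T ⊆ A, T.Nonempty → ∑ i ∈ T, f i ≠ 0) :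
    ∏ i ∈ A, (1 - AddMonoidAlgebra.single (f i) (1 : k)) ≠ 0 := by
  intro h
  have hsum : ∑ T ∈ A.powerset,
      AddMonoidAlgebra.single (∑ i ∈ T, f i) ((-1 : k) ^ T.card) = 0 := by
    rw [← h, Finset.prod_sub]
    refine Finset.sum_congr rfl fun T _ => ?_
    rw [Finset.prod_const_one, mul_one, AddMonoidAlgebra.prod_single, Finset.prod_const_one]
    have : (-1 : AddMonoidAlgebra k G) ^ T.card =
        AddMonoidAlgebra.single 0 ((-1 : k) ^ T.card) := by
      rcases Nat.even_or_odd T.card with h' | h'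
      · rw [h'.neg_one_pow, h'.neg_one_pow, AddMonoidAlgebra.one_def]
      · rw [h'.neg_one_pow, h'.neg_one_pow, AddMonoidAlgebra.one_def, AddMonoidAlgebra.single_neg]
    rw [this, AddMonoidAlgebra.single_mul_single, zero_add, mul_one]
  have h0 := congrArg (fun a : AddMonoidAlgebra k G => a.coeff 0) hsum
  simp only [AddMonoidAlgebra.coeff_sum, AddMonoidAlgebra.coeff_single, Finsupp.finsetSum_apply,
    AddMonoidAlgebra.coeff_zero, Finsupp.coe_zero, Pi.zero_apply] at h0
  rw [Finset.sum_eq_single ∅] at h0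
  · simp at h0
  · intro T hT hne
    rw [Finsupp.single_apply, if_neg]
    exact hA T (Finset.mem_powerset.1 hT) (Finset.nonempty_iff_ne_empty.2 hne)
  · simp

/-- Olson-type bound: the number of elements of a zero-sumfree family in a `p`-group, weighted by
their divisibility. -/
theorem sum_div_le_of_zeroSumFree {G κ ι : Type*} [AddCommGroup G] [Fintype κ] {p : ℕ}
    (hp : p.Prime) {a : ℕ} (u : κ → G) (hu : ∀ i, p ^ a • u i = 0)
    (hgen : ∀ Q, Q ∣ p ^ a → ∀ g : G, Q • g = 0 → ∃ c : κ → ℕ, g = (p ^ a / Q) • ∑ i, c i • u i)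
    (f : ι → G) (A : Finset ι) (hA : ∀ T ⊆ A, T.Nonempty → ∑ i ∈ T, f i ≠ 0) (Q : ι → ℕ)
    (hQ : ∀ i ∈ A, Q i ∣ p ^ a) (hf : ∀ i ∈ A, Q i • f i = 0) :
    ∑ i ∈ A, p ^ a / Q i ≤ Fintype.card κ * p ^ a := by
  have : Fact p.Prime := ⟨hp⟩
  have : CharP (AddMonoidAlgebra (ZMod p) G) p :=
    charP_of_injective_algebraMap (algebraMap (ZMod p) _).injective p
  let X : G → AddMonoidAlgebra (ZMod p) G := fun g => AddMonoidAlgebra.single g 1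
  have hpow : ∀ (g : G) (b : ℕ), (1 - X g) ^ p ^ b = 1 - X (p ^ b • g) := by
    intro g b
    rw [sub_pow_char_pow, one_pow, AddMonoidAlgebra.single_pow, one_pow]
  let I : Ideal (AddMonoidAlgebra (ZMod p) G) :=
    Ideal.span ((fun i => 1 - X (u i)) '' (Finset.univ : Finset κ))
  have hI : I ^ (Fintype.card κ * p ^ a + 1) = ⊥ := by
    refine span_pow_mul_succ_eq_bot _ _ fun i _ => ?_
    rw [hpow, hu, sub_eq_zero]
    rfl
  have hmem : ∀ c : κ → ℕ, 1 - X (∑ i, c i • u i) ∈ I := by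
    intro c
    have h1 : X (∑ i, c i • u i) = ∏ i, X (u i) ^ c i := by
      simp only [X, AddMonoidAlgebra.single_pow, one_pow, AddMonoidAlgebra.prod_single,
        Finset.prod_const_one]
    rw [h1, ← Ideal.Quotient.mk_eq_mk_iff_sub_mem, map_prod, map_one, eq_comm]
    refine Finset.prod_eq_one fun i _ => ?_
    have h2 : Ideal.Quotient.mk I (X (u i)) = 1 := by
      rw [eq_comm, ← map_one (Ideal.Quotient.mk I), Ideal.Quotient.mk_eq_mk_iff_sub_mem]
      exact Ideal.subset_span ⟨i, by simp, rfl⟩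
    rw [map_pow, h2, one_pow]
  by_contra! hlt
  refine prod_one_sub_single_ne_zero (k := ZMod p) f A hA ?_
  have hprod : ∏ i ∈ A, (1 - X (f i)) ∈ ∏ i ∈ A, I ^ (p ^ a / Q i) := by
    refine Ideal.prod_mem_prod fun i hi => ?_
    obtain ⟨c, hc⟩ := hgen _ (hQ i hi) _ (hf i hi)
    obtain ⟨b, -, hb⟩ := (Nat.dvd_prime_pow hp).1 (Nat.div_dvd_of_dvd (hQ i hi))
    rw [hc, hb, ← hpow]
    exact Ideal.pow_mem_pow (hmem c) _
  rw [Finset.prod_pow_eq_pow_sum] at hprod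
  have := Ideal.pow_le_pow_right (Nat.succ_le_of_lt hlt) hprod
  rw [Nat.succ_eq_add_one, hI] at this
  exact this

/-- Every `d > 1` has a prime power component dominating all its prime divisors. -/
theorem exists_dominant_prime_power {d : ℕ} (hd : 1 < d) :
    ∃ p ∈ d.primeFactors, (∀ q ∈ d.primeFactors, q ≤ p ^ d.factorization p) ∧
      d ≤ (p ^ d.factorization p) ^ d.primeFactors.card := by
  have hd0 : d ≠ 0 := by omega
  obtain ⟨p, hp, hmax⟩ := Finset.exists_max_image d.primeFactors (fun q => q ^ d.factorization q)
    (Nat.nonempty_primeFactors.2 hd)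
  refine ⟨p, hp, fun q hq => ?_, ?_⟩
  · refine le_trans ?_ (hmax q hq)
    exact Nat.le_self_pow ((Nat.prime_of_mem_primeFactors hq).factorization_pos_of_dvd hd0
      (Nat.dvd_of_mem_primeFactors hq)).ne' q
  · conv_lhs => rw [← Nat.prod_factorization_pow_eq_self hd0]
    exact Finset.prod_le_pow_card _ _ _ hmax

/-- The Olson-type bound applied to the sums over disjoint subfamilies of a zero-sumfree family. -/
theorem sum_card_div_le_of_disjoint {G κ ι : Type*} [AddCommGroup G] [Fintype κ] {p : ℕ}
    (hp : p.Prime) {a : ℕ} (u : κ → G) (hu : ∀ i, p ^ a • u i = 0)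
    (hgen : ∀ Q, Q ∣ p ^ a → ∀ g : G, Q • g = 0 → ∃ c : κ → ℕ, g = (p ^ a / Q) • ∑ i, c i • u i)
    (f : ι → G) (A : Finset ι) (hA : ∀ T ⊆ A, T.Nonempty → ∑ i ∈ T, f i ≠ 0)
    (D : Finset ℕ) (M : ℕ → ℕ) (hM : ∀ d ∈ D, M d ∣ p ^ a) (𝒯 : ℕ → Finset (Finset ι))
    (hsub : ∀ d ∈ D, ∀ T ∈ 𝒯 d, T ⊆ A ∧ T.Nonempty ∧ M d • ∑ i ∈ T, f i = 0)
    (hord : ∀ d ∈ D, ∀ T ∈ 𝒯 d, ∀ i ∈ T, addOrderOf (f i) = d)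
    (hdisj : ∀ d ∈ D, (𝒯 d : Set (Finset ι)).PairwiseDisjoint id) :
    ∑ d ∈ D, ((𝒯 d).card : ℝ) / M d ≤ Fintype.card κ := by
  have hP : 0 < p ^ a := pow_pos hp.pos a
  have key := sum_div_le_of_zeroSumFree hp u hu hgen
    (fun x : (_ : ℕ) × Finset ι => ∑ i ∈ x.2, f i) (D.sigma 𝒯) ?_ (fun x => M x.1)
    (fun x hx => hM _ (Finset.mem_sigma.1 hx).1)
    (fun x hx => (hsub _ (Finset.mem_sigma.1 hx).1 _ (Finset.mem_sigma.1 hx).2).2.2)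
  · rw [Finset.sum_sigma] at key
    have key' : (∑ d ∈ D, ((𝒯 d).card : ℝ) / M d) * (p ^ a : ℕ) ≤
        Fintype.card κ * (p ^ a : ℕ) := by
      refine le_trans (le_of_eq ?_) (by exact_mod_cast key :
        ((∑ d ∈ D, ∑ _T ∈ 𝒯 d, p ^ a / M d : ℕ) : ℝ) ≤ _)
      rw [Finset.sum_mul]
      push_cast
      refine Finset.sum_congr rfl fun d hd => ?_
      have h0 : (M d : ℝ) ≠ 0 := by
        have := Nat.pos_of_dvd_of_pos (hM d hd) hP
        positivity
      rw [Finset.sum_const, nsmul_eq_mul, Nat.cast_div (hM d hd) h0]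
      push_cast
      ring
    exact le_of_mul_le_mul_right key' (by exact_mod_cast hP)
  · intro B hB hBne
    have hmem : ∀ x ∈ B, x.1 ∈ D ∧ x.2 ∈ 𝒯 x.1 := fun x hx => Finset.mem_sigma.1 (hB hx)
    have hdis : (B : Set ((_ : ℕ) × Finset ι)).PairwiseDisjoint fun x => x.2 := by
      rintro ⟨d, T⟩ hx ⟨d', T'⟩ hy hxy
      obtain ⟨hd, hT⟩ := hmem _ hx
      obtain ⟨hd', hT'⟩ := hmem _ hy
      by_cases hdd : d = d'
      · subst hdd
        exact hdisj d hd hT hT' fun h => hxy (by simp_all)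
      · refine Finset.disjoint_left.2 fun i hi hi' => hdd ?_
        rw [← hord d hd T hT i hi, hord d' hd' T' hT' i hi']
    rw [← Finset.sum_biUnion hdis]
    refine hA _ (Finset.biUnion_subset.2 fun x hx => (hsub _ (hmem x hx).1 _ (hmem x hx).2).1) ?_
    obtain ⟨x, hx⟩ := hBne
    obtain ⟨i, hi⟩ := (hsub _ (hmem x hx).1 _ (hmem x hx).2).2.1
    exact ⟨i, Finset.mem_biUnion.2 ⟨x, hx, hi⟩⟩

/-- Upper bound for the cross number of a zero-sumfree family. -/
theorem sum_inv_addOrderOf_le {G ι : Type*} [AddCommGroup G] [Finite G] {n r : ℕ} (hn : n ≠ 0)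
    (hrank : ∀ q : ℕ, q.Prime → q ∣ n → Nat.card (nsmulAddMonoidHom (α := G) q).ker ≤ q ^ r)
    (hnG : ∀ g : G, n • g = 0) (F : ℕ → ℕ) (hF : Monotone F) (hF1 : ∀ q, 1 ≤ F q)
    (hFq : ∀ q, (128 * r * (Nat.log 2 q + 1)) ^ r ≤ F q)
    {κ : ℕ → Type*} [∀ p, Fintype (κ p)] (u : ∀ p, κ p → G)
    (hu : ∀ p ∈ n.primeFactors, ∀ i, p ^ n.factorization p • u p i = 0)
    (hgen : ∀ p ∈ n.primeFactors, ∀ Q, Q ∣ p ^ n.factorization p → ∀ g : G, Q • g = 0 →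
      ∃ c : κ p → ℕ, g = (p ^ n.factorization p / Q) • ∑ i, c i • u p i)
    (f : ι → G) (A : Finset ι) (hA : ∀ T ⊆ A, T.Nonempty → ∑ i ∈ T, f i ≠ 0) :
    ∃ M : ℕ → ℕ, (∀ d ∈ n.divisors.erase 1, 0 < M d ∧ d ≤ M d ^ n.primeFactors.card) ∧
      ∑ i ∈ A, (1 : ℝ) / addOrderOf (f i) ≤ ∑ p ∈ n.primeFactors, (Fintype.card (κ p) : ℝ) +
        ∑ d ∈ n.divisors.erase 1, 3 * (F (M d) : ℝ) / M d := by
  have hdiv : ∀ d ∈ n.divisors.erase 1, 1 < d ∧ d ∣ n := by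
    intro d hd
    obtain ⟨h1, h2⟩ := Finset.mem_erase.1 hd
    have := Nat.pos_of_mem_divisors h2
    exact ⟨by omega, Nat.dvd_of_mem_divisors h2⟩
  have hdom : ∀ d, ∃ p, d ∈ n.divisors.erase 1 → p ∈ d.primeFactors ∧
      (∀ q ∈ d.primeFactors, q ≤ p ^ d.factorization p) ∧
      d ≤ (p ^ d.factorization p) ^ d.primeFactors.card := by
    intro d
    by_cases hd : d ∈ n.divisors.erase 1
    · obtain ⟨p, hp⟩ := exists_dominant_prime_power (hdiv d hd).1
      exact ⟨p, fun _ => hp⟩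
    · exact ⟨0, fun h => absurd h hd⟩
  choose P hP using hdom
  have hMpos : ∀ d ∈ n.divisors.erase 1, 0 < P d ^ d.factorization (P d) := fun d hd =>
    pow_pos (Nat.prime_of_mem_primeFactors (hP d hd).1).pos _
  have hfam : ∀ d, ∃ 𝒯 : Finset (Finset ι), d ∈ n.divisors.erase 1 →
      (∀ T ∈ 𝒯, T ⊆ A.filter (fun i => addOrderOf (f i) = d) ∧
        T.card = d / P d ^ d.factorization (P d) ∧
        (P d ^ d.factorization (P d)) • ∑ i ∈ T, f i = 0) ∧
      (𝒯 : Set (Finset ι)).PairwiseDisjoint id ∧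
      (A.filter (fun i => addOrderOf (f i) = d)).card ≤
        3 * F (P d ^ d.factorization (P d)) * (d / P d ^ d.factorization (P d)) +
          d / P d ^ d.factorization (P d) * 𝒯.card := by
    intro d
    by_cases hd : d ∈ n.divisors.erase 1
    swap
    · exact ⟨∅, fun h => absurd h hd⟩
    obtain ⟨hd1, hdn⟩ := hdiv d hd
    have hd0 : d ≠ 0 := by omega
    set M := P d ^ d.factorization (P d) with hM
    have hMd : M ∣ d := Nat.ordProj_dvd d (P d)
    have hm : 0 < d / M := Nat.div_pos (Nat.le_of_dvd (by omega) hMd) (hMpos d hd)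
    have hext : ∀ B ⊆ A.filter (fun i => addOrderOf (f i) = d), 3 * F M * (d / M) ≤ B.card →
        ∃ T ⊆ B, T.card = d / M ∧ M • ∑ i ∈ T, f i = 0 := by
      intro B hB hBc
      have hq : ∀ q : ℕ, q.Prime → q ∣ d / M → q ∣ d := fun q _ h =>
        h.trans (Nat.div_dvd_of_dvd hMd)
      obtain ⟨T, hT, hTc, hTs⟩ :=
        exists_zero_sum_of_torsion (G := G) (r := r) (hF1 M) (d / M) hm.ne'
        (fun q hq' h => hrank q hq' ((hq q hq' h).trans hdn))
        (fun q hq' h => (hFq q).trans (hF ((hP d hd).2.1 q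
          (Nat.mem_primeFactors.2 ⟨hq', hq q hq' h, hd0⟩))))
        (fun i => M • f i) B
        (fun i hi => by
          rw [← mul_nsmul, Nat.mul_div_cancel' hMd, ← (Finset.mem_filter.1 (hB hi)).2]
          exact addOrderOf_nsmul_eq_zero _)
        (by omega)
      exact ⟨T, hT, hTc, by rw [Finset.smul_sum]; exact hTs⟩
    obtain ⟨𝒯, h1, h2, h3⟩ := exists_disjoint_family hm _ _ hext
    exact ⟨𝒯, fun _ => ⟨h1, h2, h3⟩⟩
  choose 𝒯 h𝒯 using hfam
  refine ⟨fun d => P d ^ d.factorization (P d), fun d hd => ⟨hMpos d hd, ?_⟩, ?_⟩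
  · refine (hP d hd).2.2.trans (Nat.pow_le_pow_right (hMpos d hd) ?_)
    exact Finset.card_le_card (Nat.primeFactors_mono (hdiv d hd).2 hn)
  have hord : ∀ i ∈ A, addOrderOf (f i) ∈ n.divisors.erase 1 := by
    intro i hi
    refine Finset.mem_erase.2 ⟨fun h => ?_, Nat.mem_divisors.2 ⟨?_, hn⟩⟩
    · refine hA {i} (by simpa using hi) (by simp) ?_
      simpa using AddMonoid.addOrderOf_eq_one_iff.1 h
    · exact addOrderOf_dvd_of_nsmul_eq_zero (hnG _)
  have hsplit : ∑ i ∈ A, (1 : ℝ) / addOrderOf (f i) = ∑ d ∈ n.divisors.erase 1,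
      ((A.filter (fun i => addOrderOf (f i) = d)).card : ℝ) / d := by
    rw [← Finset.sum_fiberwise_of_maps_to hord]
    refine Finset.sum_congr rfl fun d _ => ?_
    rw [Finset.sum_congr rfl (g := fun _ => (1 : ℝ) / d)
      fun i hi => by rw [(Finset.mem_filter.1 hi).2]]
    rw [Finset.sum_const, nsmul_eq_mul, mul_one_div]
  have hterm : ∀ d ∈ n.divisors.erase 1,
      ((A.filter (fun i => addOrderOf (f i) = d)).card : ℝ) / d ≤
        ((𝒯 d).card : ℝ) / (P d ^ d.factorization (P d) : ℕ) +
          3 * (F (P d ^ d.factorization (P d)) : ℝ) / (P d ^ d.factorization (P d) : ℕ) := by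
    intro d hd
    obtain ⟨hd1, hdn⟩ := hdiv d hd
    have h := (h𝒯 d hd).2.2
    have hM := hMpos d hd
    have hMd : P d ^ d.factorization (P d) ∣ d := Nat.ordProj_dvd d (P d)
    generalize P d ^ d.factorization (P d) = M at h hM hMd ⊢
    obtain ⟨m, rfl⟩ := hMd
    rw [Nat.mul_div_cancel_left _ hM] at h
    have hm : 0 < m := Nat.pos_of_ne_zero fun h => by simp [h] at hd1
    have hM' : (0 : ℝ) < M := by exact_mod_cast hM
    have hm' : (0 : ℝ) < m := by exact_mod_cast hm
    have h' : ((A.filter (fun i => addOrderOf (f i) = M * m)).card : ℝ) ≤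
        3 * F M * m + m * (𝒯 (M * m)).card := by exact_mod_cast h
    rw [← add_div, div_le_div_iff₀ (by positivity) hM']
    push_cast
    nlinarith [mul_le_mul_of_nonneg_right h' hM'.le]
  rw [hsplit]
  refine (Finset.sum_le_sum hterm).trans ?_
  rw [Finset.sum_add_distrib]
  refine add_le_add_left ?_ _
  have hPn : ∀ d ∈ n.divisors.erase 1, P d ∈ n.primeFactors := fun d hd =>
    Nat.primeFactors_mono (hdiv d hd).2 hn (hP d hd).1
  rw [← Finset.sum_fiberwise_of_maps_to hPn]
  refine Finset.sum_le_sum fun p hp => ?_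
  have hpp := Nat.prime_of_mem_primeFactors hp
  refine sum_card_div_le_of_disjoint hpp (u p) (hu p hp) (hgen p hp) f A hA _
    (fun d => P d ^ d.factorization (P d)) ?_ 𝒯 ?_ ?_ ?_
  · intro d hd
    obtain ⟨hdn, rfl⟩ := Finset.mem_filter.1 hd
    exact pow_dvd_pow _ ((Nat.factorization_le_iff_dvd (by have := hdiv d hdn; omega) hn).2
      (hdiv d hdn).2 _)
  · intro d hd T hT
    obtain ⟨hdn, rfl⟩ := Finset.mem_filter.1 hd
    obtain ⟨h1, h2, h3⟩ := (h𝒯 d hdn).1 T hT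
    refine ⟨h1.trans (Finset.filter_subset _ _), Finset.card_pos.1 ?_, h3⟩
    rw [h2]
    exact Nat.div_pos (Nat.le_of_dvd (by have := hdiv d hdn; omega) (Nat.ordProj_dvd d _))
      (hMpos d hdn)
  · intro d hd T hT i hi
    exact (Finset.mem_filter.1 (((h𝒯 d (Finset.mem_filter.1 hd).1).1 T hT).1 hi)).2
  · intro d hd
    exact (h𝒯 d (Finset.mem_filter.1 hd).1).2.1

theorem sum_divisors_rpow_neg_le {s x : ℝ} (hx1 : x < 1) (n : ℕ)
    (hn : n ≠ 0) (hx : ∀ q ∈ n.primeFactors, (q : ℝ) ^ (-s) ≤ x) :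
    ∑ d ∈ n.divisors, (d : ℝ) ^ (-s) ≤ ((1 - x)⁻¹) ^ n.primeFactors.card := by
  induction n using Nat.recOnPosPrimePosCoprime with
  | zero => exact absurd rfl hn
  | one => simp
  | prime_pow p k hp hk =>
    have hpx := hx p (by simp [Nat.primeFactors_prime_pow hk.ne' hp])
    have h0 : (0 : ℝ) ≤ (p : ℝ) ^ (-s) := by positivity
    rw [Nat.sum_divisors_prime_pow hp, Nat.primeFactors_prime_pow hk.ne' hp,
      Finset.card_singleton, pow_one]
    have hsum : ∑ b ∈ Finset.range (k + 1), ((p ^ b : ℕ) : ℝ) ^ (-s) =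
        ∑ b ∈ Finset.range (k + 1), ((p : ℝ) ^ (-s)) ^ b := by
      refine Finset.sum_congr rfl fun b _ => ?_
      rw [Nat.cast_pow, ← Real.rpow_natCast, ← Real.rpow_mul (by positivity), mul_comm,
        Real.rpow_mul (by positivity), Real.rpow_natCast]
    rw [hsum]
    refine ((summable_geometric_of_lt_one h0 (hpx.trans_lt hx1)).sum_le_tsum _
      fun b _ => by positivity).trans ?_
    rw [tsum_geometric_of_lt_one h0 (hpx.trans_lt hx1)]
    have : 0 < 1 - x := by linarith
    gcongr
  | coprime a b ha hb hab iha ihb =>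
    have hx' : ∀ q, q ∈ a.primeFactors ∨ q ∈ b.primeFactors → (q : ℝ) ^ (-s) ≤ x := fun q hq =>
      hx q (by rw [hab.primeFactors_mul]; exact Finset.mem_union.2 hq)
    have h1 := iha (by omega) fun q hq => hx' q (Or.inl hq)
    have h2 := ihb (by omega) fun q hq => hx' q (Or.inr hq)
    rw [hab.primeFactors_mul, Finset.card_union_of_disjoint hab.disjoint_primeFactors, pow_add]
    have h3 : ∑ d ∈ (a * b).divisors, (d : ℝ) ^ (-s) =
        (∑ d ∈ a.divisors, (d : ℝ) ^ (-s)) * ∑ d ∈ b.divisors, (d : ℝ) ^ (-s) := by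
      rw [Nat.divisors_mul, Finset.mul_def, Finset.sum_image (Nat.Coprime.mul_injOn_divisors hab),
        Finset.sum_product, Finset.sum_mul_sum]
      refine Finset.sum_congr rfl fun i _ => Finset.sum_congr rfl fun j _ => ?_
      rw [Nat.cast_mul, Real.mul_rpow (by positivity) (by positivity)]
    rw [h3]
    have h4 : 0 < 1 - x := by linarith
    gcongr

/-- The quantity `(log M) ^ r / M` is `O(M ^ (-1/2))`. -/
theorem exists_log_pow_le_mul_rpow (r : ℕ) (hr : 1 ≤ r) : ∃ C : ℝ, 0 < C ∧ ∀ M : ℕ, 0 < M →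
    (((128 * r * (Nat.log 2 M + 1)) ^ r + 1 : ℕ) : ℝ) / M ≤ C * (M : ℝ) ^ (-(1 / 2) : ℝ) := by
  have hr0 : (0 : ℝ) < r := by exact_mod_cast hr
  set t : ℝ := 1 / (2 * r) with ht
  have ht0 : 0 < t := by positivity
  have hl2 : 0 < Real.log 2 := Real.log_pos (by norm_num)
  set K : ℝ := 1 / (t * Real.log 2) + 1 with hK
  have hK0 : 0 < K := by positivity
  refine ⟨(128 * r * K) ^ r + 1, by positivity, fun M hM => ?_⟩
  have hM1 : (1 : ℝ) ≤ M := by exact_mod_cast hM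
  have hM0 : (0 : ℝ) < M := by linarith
  have h1 : ((Nat.log 2 M : ℕ) : ℝ) + 1 ≤ K * (M : ℝ) ^ t := by
    have h2 : ((Nat.log 2 M : ℕ) : ℝ) ≤ Real.logb (2 : ℕ) M := Real.natLog_le_logb M 2
    have h3 := Real.log_le_rpow_div hM0.le ht0
    have h4 : Real.logb (2 : ℕ) M ≤ (M : ℝ) ^ t / t / Real.log 2 := by
      rw [Real.logb, Nat.cast_ofNat]
      gcongr
    have h5 : (1 : ℝ) ≤ (M : ℝ) ^ t := Real.one_le_rpow hM1 ht0.le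
    have h6 : K * (M : ℝ) ^ t = (M : ℝ) ^ t / t / Real.log 2 + (M : ℝ) ^ t := by
      rw [hK]
      field_simp
    have h7 := h2.trans h4
    linarith
  have h2 : ((M : ℝ) ^ t) ^ r = (M : ℝ) ^ (1 / 2 : ℝ) := by
    rw [← Real.rpow_natCast, ← Real.rpow_mul hM0.le, ht]
    congr 1
    field_simp
  have h3 : (((128 * r * (Nat.log 2 M + 1)) ^ r + 1 : ℕ) : ℝ) ≤
      ((128 * r * K) ^ r + 1) * (M : ℝ) ^ (1 / 2 : ℝ) := by
    push_cast
    have h4 : (128 * (r : ℝ) * (Nat.log 2 M + 1)) ^ r ≤ (128 * r * (K * (M : ℝ) ^ t)) ^ r := by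
      gcongr
    have h5 : (1 : ℝ) ≤ (M : ℝ) ^ (1 / 2 : ℝ) := Real.one_le_rpow hM1 (by norm_num)
    rw [← mul_assoc (128 * (r : ℝ)) K, mul_pow _ ((M : ℝ) ^ t), h2] at h4
    linarith
  have h4 : (M : ℝ) ^ (1 / 2 : ℝ) = (M : ℝ) ^ (-(1 / 2) : ℝ) * M := by
    rw [← Real.rpow_add_one hM0.ne']
    norm_num
  rw [div_le_iff₀ hM0, mul_assoc ((128 * (r : ℝ) * K) ^ r + 1), ← h4]
  exact h3

theorem exists_forall_sum_error_lt (r w : ℕ) (hr : 1 ≤ r) (hw : 1 ≤ w) {ε : ℝ} (hε : 0 < ε) :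
    ∃ N : ℕ, ∀ n : ℕ, n ≠ 0 → n.primeFactors.card = w → N ≤ n.minFac → ∀ M : ℕ → ℕ,
      (∀ d ∈ n.divisors.erase 1, 0 < M d ∧ d ≤ M d ^ n.primeFactors.card) →
      ∑ d ∈ n.divisors.erase 1,
        3 * (((128 * r * (Nat.log 2 (M d) + 1)) ^ r + 1 : ℕ) : ℝ) / M d < ε := by
  obtain ⟨C, hC, hlog⟩ := exists_log_pow_le_mul_rpow r hr
  have hw0 : (0 : ℝ) < w := by exact_mod_cast hw
  set s : ℝ := 1 / (2 * w) with hs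
  have hs0 : 0 < s := by positivity
  have hlim : Filter.Tendsto (fun x : ℝ => 3 * C * (((1 - x ^ (-s))⁻¹) ^ w - 1)) Filter.atTop
      (nhds (3 * C * (((1 - 0)⁻¹) ^ w - 1))) :=
    (((((tendsto_rpow_neg_atTop hs0).const_sub 1).inv₀
      (by norm_num)).pow w).sub_const 1).const_mul _
  have hev := ((hlim.comp tendsto_natCast_atTop_atTop).eventually_lt_const
    (u := ε) (by simpa using hε)).and
    (((tendsto_rpow_neg_atTop hs0).comp tendsto_natCast_atTop_atTop).eventually_lt_const
      (u := 1) one_pos)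
  obtain ⟨N, hN, hN1⟩ := (hev.and (Filter.eventually_ge_atTop 1)).exists
  simp only [Function.comp_apply] at hN
  refine ⟨N, fun n hn hnw hmin M hM => lt_of_le_of_lt ?_ hN.1⟩
  have hsum := sum_divisors_rpow_neg_le (s := s) hN.2 n hn fun q hq => by
    have : N ≤ q := hmin.trans (Nat.minFac_le_of_dvd (Nat.prime_of_mem_primeFactors hq).two_le
      (Nat.dvd_of_mem_primeFactors hq))
    exact Real.rpow_le_rpow_of_nonpos (by exact_mod_cast hN1) (by exact_mod_cast this)
      (by linarith)
  rw [← Finset.add_sum_erase _ _ (Nat.one_mem_divisors.2 hn), Nat.cast_one, Real.one_rpow,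
    hnw] at hsum
  have hterm : ∀ d ∈ n.divisors.erase 1,
      3 * (((128 * r * (Nat.log 2 (M d) + 1)) ^ r + 1 : ℕ) : ℝ) / M d ≤
        3 * C * (d : ℝ) ^ (-s) := by
    intro d hd
    obtain ⟨hM0, hdM⟩ := hM d hd
    have hd0 : 0 < d := Nat.pos_of_mem_divisors (Finset.mem_of_mem_erase hd)
    have h1 : (M d : ℝ) ^ (-(1 / 2) : ℝ) ≤ (d : ℝ) ^ (-s) := by
      have h2 : (M d : ℝ) ^ (-(1 / 2) : ℝ) = ((M d ^ w : ℕ) : ℝ) ^ (-s) := by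
        rw [Nat.cast_pow, ← Real.rpow_natCast, ← Real.rpow_mul (by positivity), hs]
        congr 1
        field_simp
      rw [h2]
      exact Real.rpow_le_rpow_of_nonpos (by exact_mod_cast hd0)
        (by rw [← hnw]; exact_mod_cast hdM) (by linarith)
    calc 3 * (((128 * r * (Nat.log 2 (M d) + 1)) ^ r + 1 : ℕ) : ℝ) / M d
        = 3 * ((((128 * r * (Nat.log 2 (M d) + 1)) ^ r + 1 : ℕ) : ℝ) / M d) := by ring
      _ ≤ 3 * (C * (M d : ℝ) ^ (-(1 / 2) : ℝ)) := by gcongr; exact hlog _ hM0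
      _ ≤ 3 * (C * (d : ℝ) ^ (-s)) := by gcongr
      _ = 3 * C * (d : ℝ) ^ (-s) := by ring
  refine (Finset.sum_le_sum hterm).trans ?_
  rw [← Finset.mul_sum]
  gcongr
  linarith

theorem factorization_eq_of_coprime_div {N m p : ℕ} (hm : m ≠ 0) (hNm : N ∣ m)
    (hgcd : Nat.gcd N (m / N) = 1) (hp : p.Prime) (hpN : p ∣ N) :
    N.factorization p = m.factorization p := by
  obtain ⟨c, rfl⟩ := hNm
  have hN : N ≠ 0 := fun h => hm (by simp [h])
  have hc : c ≠ 0 := fun h => hm (by simp [h])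
  rw [Nat.mul_div_cancel_left _ (Nat.pos_of_ne_zero hN)] at hgcd
  have hpc : ¬ p ∣ c := fun h => hp.one_lt.ne' (Nat.eq_one_of_dvd_coprimes hgcd hpN h)
  rw [Nat.factorization_mul hN hc, Finsupp.add_apply, Nat.factorization_eq_zero_of_not_dvd hpc,
    add_zero]

theorem exists_eq_natCast_of_nsmul_eq_zero {N P Q : ℕ} [NeZero N] (hPN : P ∣ N) (hQP : Q ∣ P)
    (x : ZMod N) (hx : Q • x = 0) : ∃ c : ℕ, x = ((P / Q * (N / P) * c : ℕ) : ZMod N) := by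
  obtain ⟨b, rfl⟩ := hQP
  obtain ⟨c, rfl⟩ := hPN
  have h0 : Q * b * c ≠ 0 := NeZero.ne _
  have hQ : 0 < Q := Nat.pos_of_ne_zero fun h => h0 (by simp [h])
  have hb : 0 < b := Nat.pos_of_ne_zero fun h => h0 (by simp [h])
  rw [Nat.mul_div_cancel_left _ hQ, Nat.mul_div_cancel_left _ (Nat.mul_pos hQ hb)]
  have h1 : ((Q * x.val : ℕ) : ZMod (Q * b * c)) = 0 := by
    rw [Nat.cast_mul, ZMod.natCast_zmod_val, ← nsmul_eq_mul, hx]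
  have h2 : Q * (b * c) ∣ Q * x.val := by
    rw [← mul_assoc]
    exact (ZMod.natCast_eq_zero_iff _ _).1 h1
  obtain ⟨k, hk⟩ := Nat.dvd_of_mul_dvd_mul_left hQ h2
  exact ⟨k, by rw [← hk, ZMod.natCast_zmod_val]⟩

/-- The standard generators of the `p`-primary part of a sum of cyclic groups. -/
noncomputable def primaryGenerator {r : ℕ} (n : Fin r → ℕ) (m p : ℕ) (i : {i // p ∣ n i}) :
    ∀ i, ZMod (n i) :=
  Pi.single i.1 ((n i.1 / p ^ m.factorization p : ℕ) : ZMod (n i.1))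

theorem nsmul_primaryGenerator {r : ℕ} {n : Fin r → ℕ} {m : ℕ} (hm : m ≠ 0) (hn : ∀ i, n i ∣ m)
    (hgcd : ∀ i, Nat.gcd (n i) (m / n i) = 1) {p : ℕ} (hp : p.Prime) (i : {i // p ∣ n i}) :
    p ^ m.factorization p • primaryGenerator n m p i = 0 := by
  have hd : p ^ m.factorization p ∣ n i.1 := by
    rw [← factorization_eq_of_coprime_div hm (hn i.1) (hgcd i.1) hp i.2]
    exact Nat.ordProj_dvd _ _
  rw [primaryGenerator, ← Pi.single_smul, nsmul_eq_mul, ← Nat.cast_mul, Nat.mul_div_cancel' hd,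
    ZMod.natCast_self, Pi.single_zero]

theorem exists_eq_nsmul_sum_primaryGenerator {r : ℕ} {n : Fin r → ℕ} {m : ℕ} (hm : m ≠ 0)
    (hn : ∀ i, n i ∣ m) (hgcd : ∀ i, Nat.gcd (n i) (m / n i) = 1) {p : ℕ} (hp : p.Prime) {Q : ℕ}
    (hQ : Q ∣ p ^ m.factorization p) (g : ∀ i, ZMod (n i)) (hg : Q • g = 0) :
    ∃ c : {i // p ∣ n i} → ℕ,
      g = (p ^ m.factorization p / Q) • ∑ i, c i • primaryGenerator n m p i := by
  have hn0 : ∀ i, NeZero (n i) := fun i => ⟨fun h => hm (by simpa [h] using hn i)⟩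
  have hd : ∀ i : {i // p ∣ n i}, p ^ m.factorization p ∣ n i.1 := fun i => by
    rw [← factorization_eq_of_coprime_div hm (hn i.1) (hgcd i.1) hp i.2]
    exact Nat.ordProj_dvd _ _
  choose c hc using fun i : {i // p ∣ n i} =>
    exists_eq_natCast_of_nsmul_eq_zero (hd i) hQ (g i.1) (congrFun hg i.1)
  refine ⟨c, funext fun j => ?_⟩
  rw [Pi.smul_apply, Finset.sum_apply]
  by_cases hj : p ∣ n j
  · rw [Finset.sum_eq_single ⟨j, hj⟩]
    · rw [hc ⟨j, hj⟩, Pi.smul_apply, primaryGenerator, Pi.single_eq_same]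
      push_cast
      simp only [nsmul_eq_mul]
      ring
    · intro i _ hij
      rw [Pi.smul_apply, primaryGenerator, Pi.single_eq_of_ne, smul_zero]
      rintro rfl
      exact hij rfl
    · simp
  · rw [Finset.sum_eq_zero, smul_zero]
    · have hcop : Nat.Coprime Q (n j) := by
        refine Nat.Coprime.coprime_dvd_left hQ (Nat.Coprime.pow_left _ ?_)
        exact (Nat.Prime.coprime_iff_not_dvd hp).2 hj
      have h1 : Q • g j = 0 := congrFun hg j
      have h2 : addOrderOf (g j) ∣ Nat.gcd Q (n j) :=
        Nat.dvd_gcd (addOrderOf_dvd_of_nsmul_eq_zero h1)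
          (addOrderOf_dvd_of_nsmul_eq_zero (by simp))
      rw [hcop.gcd_eq_one, Nat.dvd_one] at h2
      exact AddMonoid.addOrderOf_eq_one_iff.1 h2
    · intro i _
      rw [Pi.smul_apply, primaryGenerator, Pi.single_eq_of_ne, smul_zero]
      rintro rfl
      exact hj i.2

theorem card_ker_nsmul_le {r : ℕ} (n : Fin r → ℕ) [∀ i, NeZero (n i)] {q : ℕ} (hq : 0 < q) :
    Nat.card (nsmulAddMonoidHom (α := ∀ i, ZMod (n i)) q).ker ≤ q ^ r := by
  let φ : (nsmulAddMonoidHom (α := ∀ i, ZMod (n i)) q).ker → ∀ i, {x : ZMod (n i) // q • x = 0} :=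
    fun g i => ⟨g.1 i, congrFun (AddMonoidHom.mem_ker.1 g.2) i⟩
  have hφ : Function.Injective φ := fun g h hgh =>
    Subtype.ext (funext fun i => congrArg Subtype.val (congrFun hgh i))
  refine (Nat.card_le_card_of_injective φ hφ).trans ?_
  rw [Nat.card_pi]
  calc ∏ i, Nat.card {x : ZMod (n i) // q • x = 0} ≤ ∏ _i : Fin r, q := by
        refine Finset.prod_le_prod' fun i _ => ?_
        rw [Nat.card_eq_fintype_card, Fintype.card_subtype]
        exact IsAddCyclic.card_nsmul_eq_zero_le hq
    _ = q ^ r := by simp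

theorem sum_card_dvd_eq {r : ℕ} {n : Fin r → ℕ} {m : ℕ} (hm : m ≠ 0) (hn : ∀ i, n i ∣ m) :
    ∑ p ∈ m.primeFactors, Fintype.card {i // p ∣ n i} = ∑ i, (n i).primeFactors.card := by
  have h1 : ∀ i, (n i).primeFactors = m.primeFactors.filter (fun p => p ∣ n i) := by
    intro i
    ext p
    have h0 : n i ≠ 0 := fun h => hm (by simpa [h] using hn i)
    simp only [Nat.mem_primeFactors, Finset.mem_filter]
    exact ⟨fun h => ⟨⟨h.1, h.2.1.trans (hn i), hm⟩, h.2.1⟩, fun h => ⟨h.1.1, h.2, h0⟩⟩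
  simp only [h1, Fintype.card_subtype]
  exact Finset.sum_card_bipartiteAbove_eq_sum_card_bipartiteBelow (fun p i => p ∣ n i)

/-- A zero-sumfree sequence is the image of a zero-sumfree family. -/
theorem exists_family_of_isZeroSumFree.{u} {G : Type u} [AddCommGroup G] {S : Multiset G}
    (hS : IsZeroSumFree S) :
    ∃ (ι : Type u) (f : ι → G) (A : Finset ι), (∀ T ⊆ A, T.Nonempty → ∑ i ∈ T, f i ≠ 0) ∧
      crossNumber S = ∑ i ∈ A, (1 : ℝ) / addOrderOf (f i) := by
  have hmap : (Finset.univ : Finset S.ToType).val.map (fun x => x.1) = S := Multiset.map_univ_coe S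
  refine ⟨S.ToType, fun x => x.1, Finset.univ, fun T hT hne => ?_, ?_⟩
  · refine hS (T.val.map fun x => x.1) ?_ ?_
    · conv_rhs => rw [← hmap]
      exact Multiset.map_le_map (Finset.val_le_iff.2 hT)
    · simpa using hne.ne_empty
  · conv_lhs => rw [crossNumber, ← hmap, Multiset.map_map]
    rfl

theorem exists_forall_crossNumber_le (r w : ℕ) (hr : 1 ≤ r) (hw : 1 ≤ w) {ε : ℝ} (hε : 0 < ε) :
    ∃ N : ℕ, ∀ (n : Fin r → ℕ) (m : ℕ), m ≠ 0 → (∀ i, n i ∣ m) →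
      (∀ i, Nat.gcd (n i) (m / n i) = 1) → m.primeFactors.card = w → N ≤ m.minFac →
      1 ≤ ∑ i, (n i).primeFactors.card → ∀ S : Multiset (∀ i, ZMod (n i)), IsMinimalZeroSum S →
      crossNumber S < ∑ i, ((n i).primeFactors.card : ℝ) + ε := by
  obtain ⟨N₁, hN₁⟩ := exists_forall_sum_error_lt r w hr hw (half_pos hε)
  obtain ⟨N₂, hN₂⟩ := exists_nat_gt (1 / (ε / 2))
  refine ⟨max N₁ N₂, fun n m hm hn hgcd hmw hmin hone S hS => ?_⟩
  have hn0 : ∀ i, NeZero (n i) := fun i => ⟨fun h => hm (by simpa [h] using hn i)⟩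
  have hmG : ∀ g : ∀ i, ZMod (n i), m • g = 0 := by
    intro g
    funext i
    obtain ⟨c, hc⟩ := hn i
    rw [Pi.smul_apply, nsmul_eq_mul, hc]
    simp
  have hone' : (1 : ℝ) ≤ ∑ i, ((n i).primeFactors.card : ℝ) := by exact_mod_cast hone
  rcases S.empty_or_exists_mem with rfl | ⟨g, hg⟩
  · simp only [crossNumber, Multiset.map_zero, Multiset.sum_zero]
    linarith
  obtain ⟨S', rfl⟩ := Multiset.exists_cons_of_mem hg
  have hcons : crossNumber (g ::ₘ S') = 1 / addOrderOf g + crossNumber S' := by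
    simp [crossNumber]
  rcases eq_or_ne S' 0 with rfl | hS'
  · have h1 : (1 : ℝ) / addOrderOf g ≤ 1 := by
      rw [div_le_one₀ (by exact_mod_cast addOrderOf_pos g)]
      exact_mod_cast addOrderOf_pos g
    rw [hcons]
    simp only [crossNumber, Multiset.map_zero, Multiset.sum_zero]
    linarith
  have hfree : IsZeroSumFree S' := fun T hT hT0 =>
    hS.2 T (hT.trans_lt (Multiset.lt_cons_self S' g)) hT0
  have hg0 : g ≠ 0 := by
    intro h
    refine hS.2 {g} ?_ (Multiset.singleton_ne_zero g) (by simpa using h)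
    rw [← Multiset.cons_zero, Multiset.cons_lt_cons_iff]
    exact pos_iff_ne_zero.2 hS'
  have hgord : (1 : ℝ) / addOrderOf g < ε / 2 := by
    have h1 : m.minFac ≤ addOrderOf g := by
      refine Nat.minFac_le_of_dvd ?_ (addOrderOf_dvd_of_nsmul_eq_zero (hmG g))
      have := addOrderOf_pos g
      have h2 : addOrderOf g ≠ 1 := fun h => hg0 (AddMonoid.addOrderOf_eq_one_iff.1 h)
      omega
    have h2 : (N₂ : ℝ) ≤ addOrderOf g := by
      exact_mod_cast (le_max_right _ _).trans (hmin.trans h1)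
    rw [div_lt_comm₀ (by exact_mod_cast addOrderOf_pos g) (half_pos hε)]
    linarith
  obtain ⟨ι, f, A, hfam, hcross⟩ := exists_family_of_isZeroSumFree hfree
  obtain ⟨M, hM, hle⟩ := sum_inv_addOrderOf_le hm (fun q hq _ => card_ker_nsmul_le n hq.pos) hmG
    (fun q => (128 * r * (Nat.log 2 q + 1)) ^ r + 1)
    (fun a b hab => by
      have := Nat.log_mono_right (b := 2) hab
      dsimp only
      gcongr)
    (fun q => by omega) (fun q => by omega) (fun p => primaryGenerator n m p)
    (fun p hp i => nsmul_primaryGenerator hm hn hgcd (Nat.prime_of_mem_primeFactors hp) i)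
    (fun p hp Q hQ g hg =>
      exists_eq_nsmul_sum_primaryGenerator hm hn hgcd (Nat.prime_of_mem_primeFactors hp) hQ g hg)
    f A hfam
  have herr := hN₁ m hm hmw ((le_max_left _ _).trans hmin) M hM
  have hsum : ∑ p ∈ m.primeFactors, (Fintype.card {i // p ∣ n i} : ℝ) =
      ∑ i, ((n i).primeFactors.card : ℝ) := by exact_mod_cast sum_card_dvd_eq hm hn
  rw [hcons, hcross]
  rw [hsum] at hle
  linarith

theorem exists_eq_sum_replicate_of_le {G κ : Type*} (e : κ → G) (b : κ → ℕ) (X : Finset κ) :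
    ∀ T : Multiset G, T ≤ ∑ x ∈ X, Multiset.replicate (b x) (e x) →
      ∃ c : κ → ℕ, (∀ x ∈ X, c x ≤ b x) ∧ T = ∑ x ∈ X, Multiset.replicate (c x) (e x) := by
  induction X using Finset.induction_on with
  | empty =>
    intro T hT
    exact ⟨0, by simp, by simpa using hT⟩
  | insert y X hy ih =>
    intro T hT
    rw [Finset.sum_insert hy] at hT
    obtain ⟨k, hk, hkT⟩ := Multiset.le_replicate_iff.1
      (Multiset.inter_le_right : T ∩ Multiset.replicate (b y) (e y) ≤ _)
    obtain ⟨c, hc, hcT⟩ := ih (T - Multiset.replicate (b y) (e y)) (by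
      rw [tsub_le_iff_left]
      exact hT)
    refine ⟨Function.update c y k, fun x hx => ?_, ?_⟩
    · rcases Finset.mem_insert.1 hx with rfl | hx
      · simpa using hk
      · rw [Function.update_of_ne (ne_of_mem_of_not_mem hx hy)]
        exact hc x hx
    · have hsum : ∑ x ∈ X, Multiset.replicate (Function.update c y k x) (e x) =
          ∑ x ∈ X, Multiset.replicate (c x) (e x) := Finset.sum_congr rfl fun x hx => by
        rw [Function.update_of_ne (ne_of_mem_of_not_mem hx hy)]
      rw [Finset.sum_insert hy, hsum, ← hcT, Function.update_self, ← hkT, add_comm,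
        Multiset.sub_add_inter]

/-- Independent elements of orders `o x` yield a minimal zero-sum sequence in which each of them
occurs at least `o x - 1` times. -/
theorem exists_isMinimalZeroSum_of_independent {G κ : Type*} [AddCommGroup G] (X : Finset κ)
    (e : κ → G) (o : κ → ℕ) (ho : ∀ x ∈ X, 0 < o x) (heo : ∀ x ∈ X, o x • e x = 0)
    (hind : ∀ c : κ → ℕ, ∑ x ∈ X, c x • e x = 0 → ∀ x ∈ X, o x ∣ c x) :
    ∃ S : Multiset G, IsMinimalZeroSum S ∧ ∑ x ∈ X, (1 - 1 / (o x : ℝ)) ≤ crossNumber S := by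
  set g : G := ∑ x ∈ X, e x with hg
  set S : Multiset G := ∑ x ∈ X, Multiset.replicate (o x - 1) (e x) with hS
  have hsum : ∀ c : κ → ℕ, (∑ x ∈ X, Multiset.replicate (c x) (e x)).sum = ∑ x ∈ X, c x • e x := by
    intro c
    rw [Multiset.sum_sum]
    simp
  have hsum' : ∀ c : κ → ℕ, (g ::ₘ ∑ x ∈ X, Multiset.replicate (c x) (e x)).sum =
      ∑ x ∈ X, (c x + 1) • e x := by
    intro c
    rw [Multiset.sum_cons, hsum, hg, ← Finset.sum_add_distrib]
    simp only [succ_nsmul']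
  have hord : ∀ x ∈ X, addOrderOf (e x) = o x := by
    intro x hx
    refine Nat.dvd_antisymm (addOrderOf_dvd_of_nsmul_eq_zero (heo x hx)) ?_
    have := hind (Pi.single x (addOrderOf (e x))) (by
      rw [Finset.sum_eq_single x]
      · simp [addOrderOf_nsmul_eq_zero]
      · intro y _ hy
        rw [Pi.single_eq_of_ne hy, zero_nsmul]
      · exact fun h => absurd hx h) x hx
    simpa using this
  refine ⟨g ::ₘ S, ⟨?_, fun T hT hT0 hT1 => ?_⟩, ?_⟩
  · rw [hsum']
    refine Finset.sum_eq_zero fun x hx => ?_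
    rw [Nat.sub_add_cancel (ho x hx), heo x hx]
  · by_cases hgT : g ∈ T
    · obtain ⟨T', rfl⟩ := Multiset.exists_cons_of_mem hgT
      obtain ⟨c, hc, rfl⟩ := exists_eq_sum_replicate_of_le e _ X T'
        ((Multiset.cons_le_cons_iff g).1 hT.le)
      rw [hsum'] at hT1
      refine hT.ne ?_
      rw [hS]
      congr 1
      refine Finset.sum_congr rfl fun x hx => ?_
      have h1 := Nat.le_of_dvd (Nat.succ_pos _) (hind (fun x => c x + 1) hT1 x hx)
      have h2 := hc x hx
      rw [show c x = o x - 1 by omega]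
    · obtain ⟨c, hc, rfl⟩ := exists_eq_sum_replicate_of_le e _ X T
        ((Multiset.le_cons_of_notMem hgT).1 hT.le)
      rw [hsum] at hT1
      refine hT0 (Finset.sum_eq_zero fun x hx => ?_)
      have h1 := hind c hT1 x hx
      have h2 := hc x hx
      have h3 := ho x hx
      rw [Nat.eq_zero_of_dvd_of_lt h1 (by omega), Multiset.replicate_zero]
  · have h1 : crossNumber S = ∑ x ∈ X, (1 - 1 / (o x : ℝ)) := by
      let φ : Multiset G →+ ℝ :=
        { toFun := crossNumber, map_zero' := by simp [crossNumber],
          map_add' := fun A B => by simp [crossNumber] }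
      change φ S = _
      rw [hS, map_sum]
      refine Finset.sum_congr rfl fun x hx => ?_
      change crossNumber (Multiset.replicate (o x - 1) (e x)) = _
      have h0 : (o x : ℝ) ≠ 0 := by exact_mod_cast (ho x hx).ne'
      rw [crossNumber, Multiset.map_replicate, Multiset.sum_replicate, hord x hx, nsmul_eq_mul,
        Nat.cast_pred (ho x hx)]
      field_simp
    rw [← h1]
    simp only [crossNumber, Multiset.map_cons, Multiset.sum_cons]
    have : (0 : ℝ) ≤ 1 / addOrderOf g := by positivity
    linarith

theorem exists_isMinimalZeroSum_pi_zmod {r : ℕ} (n : Fin r → ℕ) (hn : ∀ i, n i ≠ 0) {N : ℕ}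
    (hN : 0 < N) (hNn : ∀ i, ∀ q ∈ (n i).primeFactors, N ≤ q) :
    ∃ S : Multiset (∀ i, ZMod (n i)), IsMinimalZeroSum S ∧
      (∑ i, ((n i).primeFactors.card : ℝ)) * (1 - 1 / N) ≤ crossNumber S := by
  let o : (_ : Fin r) × ℕ → ℕ := fun x => x.2 ^ (n x.1).factorization x.2
  have hX : ∀ x ∈ Finset.univ.sigma fun i => (n i).primeFactors, x.2 ∈ (n x.1).primeFactors :=
    fun x hx => (Finset.mem_sigma.1 hx).2
  have ho : ∀ x ∈ Finset.univ.sigma fun i => (n i).primeFactors, 0 < o x := fun x hx =>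
    pow_pos (Nat.prime_of_mem_primeFactors (hX x hx)).pos _
  let e : (_ : Fin r) × ℕ → ∀ i, ZMod (n i) := fun x =>
    Pi.single x.1 ((n x.1 / o x : ℕ) : ZMod (n x.1))
  have heo : ∀ x ∈ Finset.univ.sigma fun i => (n i).primeFactors, o x • e x = 0 := by
    intro x hx
    rw [← Pi.single_smul, nsmul_eq_mul, ← Nat.cast_mul, Nat.mul_div_cancel' (Nat.ordProj_dvd _ _),
      ZMod.natCast_self, Pi.single_zero]
  have hind : ∀ c : (_ : Fin r) × ℕ → ℕ,
      ∑ x ∈ Finset.univ.sigma fun i => (n i).primeFactors, c x • e x = 0 →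
        ∀ x ∈ Finset.univ.sigma fun i => (n i).primeFactors, o x ∣ c x := by
    rintro c hc ⟨i, q⟩ hx
    have hq := hX _ hx
    have hqp := Nat.prime_of_mem_primeFactors hq
    have h1 := congrFun hc i
    rw [Finset.sum_apply, Finset.sum_sigma, Finset.sum_eq_single i] at h1
    · have h2 : ((∑ p ∈ (n i).primeFactors, c ⟨i, p⟩ * (n i / o ⟨i, p⟩) : ℕ) : ZMod (n i)) = 0 := by
        push_cast
        refine Eq.trans ?_ h1
        refine Finset.sum_congr rfl fun p _ => ?_
        simp only [e, Pi.smul_apply, Pi.single_eq_same, nsmul_eq_mul]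
      have hoq : o ⟨i, q⟩ ∣ n i := Nat.ordProj_dvd _ _
      have h3 := hoq.trans ((ZMod.natCast_eq_zero_iff _ _).1 h2)
      rw [← Finset.add_sum_erase _ _ hq, Nat.dvd_add_left] at h3
      · exact (Nat.Coprime.pow_left _ (Nat.coprime_ordCompl hqp (hn i))).dvd_of_dvd_mul_right h3
      · refine Finset.dvd_sum fun p hp => Dvd.dvd.mul_left ?_ _
        have hpq := Finset.ne_of_mem_erase hp
        have hpp := Nat.prime_of_mem_primeFactors (Finset.mem_of_mem_erase hp)
        have hcop : Nat.Coprime (o ⟨i, q⟩) (o ⟨i, p⟩) :=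
          Nat.Coprime.pow _ _ ((Nat.coprime_primes hqp hpp).2 hpq.symm)
        refine hcop.dvd_of_dvd_mul_left ?_
        rw [Nat.mul_div_cancel' (Nat.ordProj_dvd _ _)]
        exact hoq
    · intro j _ hj
      refine Finset.sum_eq_zero fun p _ => ?_
      simp only [e, Pi.smul_apply, Pi.single_eq_of_ne hj.symm, smul_zero]
    · simp
  obtain ⟨S, hS, hcross⟩ := exists_isMinimalZeroSum_of_independent _ e o ho heo hind
  refine ⟨S, hS, le_trans ?_ hcross⟩
  rw [Finset.sum_sigma, Finset.sum_mul]
  refine Finset.sum_le_sum fun i _ => ?_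
  rw [← nsmul_eq_mul]
  refine Finset.card_nsmul_le_sum _ _ _ fun q hq => ?_
  have hqp := Nat.prime_of_mem_primeFactors hq
  have h1 : N ≤ o ⟨i, q⟩ := (hNn i q hq).trans (Nat.le_self_pow
    (hqp.factorization_pos_of_dvd (hn i) (Nat.dvd_of_mem_primeFactors hq)).ne' q)
  have h2 : (N : ℝ) ≤ o ⟨i, q⟩ := by exact_mod_cast h1
  have h3 : (0 : ℝ) < N := by exact_mod_cast hN
  gcongr

theorem stmt15 (r : ℕ) (hr : 1 ≤ r) (l : Fin r → ℕ) (hl : ∀ i, 1 ≤ l i) :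
    ∀ ε : ℝ, 0 < ε → ∃ N : ℕ, ∀ n : Fin r → ℕ,
      (∀ i, 1 < n i) → (∀ i j : Fin r, i ≤ j → n i ∣ n j) →
      (∀ i, (n i).primeFactors.card = l i) →
      (∀ i, Nat.gcd (n i) (n ⟨r - 1, by omega⟩ / n i) = 1) →
      N ≤ (n ⟨r - 1, by omega⟩).minFac →
      |bigCrossNumber (∀ i : Fin r, ZMod (n i)) - ∑ i, (l i : ℝ)| < ε := by
  intro ε hε
  obtain ⟨N₁, hN₁⟩ := exists_forall_crossNumber_le r (l ⟨r - 1, by omega⟩) hr (hl _) (half_pos hε)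
  obtain ⟨N₂, hN₂⟩ := exists_nat_gt ((∑ i, (l i : ℝ)) / ε)
  refine ⟨max N₁ (N₂ + 1), fun n hn hdvd hcard hgcd hN => ?_⟩
  have hm0 : n ⟨r - 1, by omega⟩ ≠ 0 := (zero_lt_one.trans (hn _)).ne'
  have hdvdm : ∀ i, n i ∣ n ⟨r - 1, by omega⟩ := fun i => hdvd _ _ (Nat.le_sub_one_of_lt i.2)
  have hsum : 1 ≤ ∑ i, (n i).primeFactors.card := by
    rw [Finset.sum_congr rfl fun i _ => hcard i]
    exact (hl ⟨r - 1, by omega⟩).trans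
      (Finset.single_le_sum (fun _ _ => Nat.zero_le _) (Finset.mem_univ _))
  have hupper := hN₁ n _ hm0 hdvdm hgcd (hcard _) ((le_max_left _ _).trans hN) hsum
  obtain ⟨S, hS, hlower⟩ := exists_isMinimalZeroSum_pi_zmod n
    (fun i => (zero_lt_one.trans (hn i)).ne') N₂.succ_pos fun i q hq =>
      ((le_max_right _ _).trans hN).trans (Nat.minFac_le_of_dvd
        (Nat.prime_of_mem_primeFactors hq).two_le
        ((Nat.dvd_of_mem_primeFactors hq).trans (hdvdm i)))
  simp only [hcard] at hupper hlower
  have hle : bigCrossNumber (∀ i, ZMod (n i)) ≤ ∑ i, (l i : ℝ) + ε / 2 := by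
    refine csSup_le ⟨_, S, hS, rfl⟩ ?_
    rintro _ ⟨T, hT, rfl⟩
    exact (hupper T hT).le
  have hge : crossNumber S ≤ bigCrossNumber (∀ i, ZMod (n i)) := by
    refine le_csSup ⟨∑ i, (l i : ℝ) + ε / 2, ?_⟩ ⟨S, hS, rfl⟩
    rintro _ ⟨T, hT, rfl⟩
    exact (hupper T hT).le
  have hsmall : (∑ i, (l i : ℝ)) * (1 / (N₂.succ : ℕ)) < ε := by
    rw [div_lt_iff₀ hε] at hN₂
    rw [mul_one_div, div_lt_iff₀ (by positivity)]
    push_cast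
    linarith
  rw [abs_lt]
  constructor <;> linarith
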